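/- arXiv:1110.0108 — 2 statements merged into one kernel-verified Lean document; each statement's English description precedes it below -/
import Mathlib

section
/- For every real s_L there exist constants C > 0 and N₀ ∈ ℕ (depending only on s_L) such that for all N ≥ N₀, for j ∈ {N−1, N} with u_j = √(2j+1), and for all s ≥ s_L: |(2N)^{1/4} τ_N φ_j(u_j + s τ_N)| ≤ C e^{−s}, where τ_N = 2^{−1/2} N^{−1/6}. -/
open Real Filter MeasureTheory

/-- Physicists' Hermite polynomial `H_n(x) = (-1)^n e^{x²} (d^n/dx^n) e^{-x²}`. -/
noncomputable def physHermite (n : ℕ) (x : ℝ) : ℝ :=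
  (-1 : ℝ) ^ n * Real.exp (x ^ 2) * iteratedDeriv n (fun t : ℝ => Real.exp (-t ^ 2)) x

/-- Normalizing constant `h_n = √π 2^n n!`. -/
noncomputable def hNorm (n : ℕ) : ℝ := Real.sqrt Real.pi * 2 ^ n * (n.factorial : ℝ)

/-- Oscillator wave function `φ_n(x) = h_n^{-1/2} e^{-x²/2} H_n(x)`. -/
noncomputable def osc (n : ℕ) (x : ℝ) : ℝ :=
  hNorm n ^ (-(1 : ℝ) / 2) * Real.exp (-x ^ 2 / 2) * physHermite n x

/-- Airy function `Ai(x) = π⁻¹ lim_{R→∞} ∫₀^R cos(t³/3 + xt) dt`. -/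
noncomputable def Ai (x : ℝ) : ℝ :=
  Real.pi⁻¹ *
    limUnder Filter.atTop (fun R : ℝ => ∫ t in (0 : ℝ)..R, Real.cos (t ^ 3 / 3 + x * t))

/-- Scaling constant `τ_N = 2^{-1/2} N^{-1/6}`. -/
noncomputable def tauN (N : ℕ) : ℝ := (2 : ℝ) ^ (-(1 : ℝ) / 2) * (N : ℝ) ^ (-(1 : ℝ) / 6)

/-- `Δ_N = (√(2N+1) - √(2N-1))/τ_N`. -/
noncomputable def DeltaN (N : ℕ) : ℝ :=
  (Real.sqrt (2 * N + 1) - Real.sqrt (2 * N - 1)) / tauN N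

section PhysHermiteRecurrence

theorem hasDerivAt_iteratedDeriv_exp_neg_sq (n : ℕ) (x : ℝ) :
    HasDerivAt (iteratedDeriv n fun t : ℝ => Real.exp (-t ^ 2))
      (iteratedDeriv (n + 1) (fun t : ℝ => Real.exp (-t ^ 2)) x) x := by
  have h : ContDiff ℝ ⊤ fun t : ℝ => Real.exp (-t ^ 2) := by fun_prop
  rw [iteratedDeriv_succ]
  exact ((h.differentiable_iteratedDeriv n (by simp)) x).hasDerivAt

theorem iteratedDeriv_one_exp_neg_sq (x : ℝ) :
    iteratedDeriv 1 (fun t : ℝ => Real.exp (-t ^ 2)) x = -2 * x * Real.exp (-x ^ 2) := by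
  have h : HasDerivAt (fun t : ℝ => Real.exp (-t ^ 2)) (Real.exp (-x ^ 2) * (-(2 * x))) x := by
    simpa using (((hasDerivAt_id x).pow 2).neg).exp
  rw [iteratedDeriv_one, h.deriv]
  ring

theorem iteratedDeriv_add_two_exp_neg_sq (n : ℕ) (x : ℝ) :
    iteratedDeriv (n + 2) (fun t : ℝ => Real.exp (-t ^ 2)) x =
      -2 * x * iteratedDeriv (n + 1) (fun t : ℝ => Real.exp (-t ^ 2)) x -
        2 * (n + 1) * iteratedDeriv n (fun t : ℝ => Real.exp (-t ^ 2)) x := by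
  induction n generalizing x with
  | zero =>
    have h1 : iteratedDeriv 1 (fun t : ℝ => Real.exp (-t ^ 2)) =
        fun x => -2 * x * Real.exp (-x ^ 2) := funext iteratedDeriv_one_exp_neg_sq
    have h0 := hasDerivAt_iteratedDeriv_exp_neg_sq 0 x
    have h := hasDerivAt_iteratedDeriv_exp_neg_sq 1 x
    rw [h1] at h
    simp only [iteratedDeriv_zero] at h0
    have h' := ((hasDerivAt_id x).const_mul (-2)).mul h0
    have := h.unique h'
    simp only [id] at this
    simp only [zero_add, iteratedDeriv_zero, Nat.cast_zero] at *
    rw [this]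
    ring
  | succ n ih =>
    have h1 : iteratedDeriv (n + 2) (fun t : ℝ => Real.exp (-t ^ 2)) = fun x =>
      -2 * x * iteratedDeriv (n + 1) (fun t : ℝ => Real.exp (-t ^ 2)) x -
        2 * (n + 1) * iteratedDeriv n (fun t : ℝ => Real.exp (-t ^ 2)) x := funext ih
    have h := hasDerivAt_iteratedDeriv_exp_neg_sq (n + 2) x
    rw [h1] at h
    have h' := (((hasDerivAt_id x).const_mul (-2)).mul
      (hasDerivAt_iteratedDeriv_exp_neg_sq (n + 1) x)).sub
      ((hasDerivAt_iteratedDeriv_exp_neg_sq n x).const_mul (2 * ((n : ℝ) + 1)))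
    have := h.unique h'
    simp only [id] at this
    rw [show n + 1 + 2 = n + 2 + 1 by ring, this, show n + 1 + 1 = n + 2 by ring]
    push_cast
    ring

theorem physHermite_zero (x : ℝ) : physHermite 0 x = 1 := by
  simp [physHermite, ← Real.exp_add]

theorem physHermite_one (x : ℝ) : physHermite 1 x = 2 * x := by
  have h : Real.exp (x ^ 2) * Real.exp (-x ^ 2) = 1 := by simp [← Real.exp_add]
  rw [physHermite, iteratedDeriv_one_exp_neg_sq]
  linear_combination 2 * x * h

theorem physHermite_add_two (n : ℕ) (x : ℝ) :
    physHermite (n + 2) x = 2 * x * physHermite (n + 1) x - 2 * (n + 1) * physHermite n x := by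
  simp only [physHermite, iteratedDeriv_add_two_exp_neg_sq]
  ring

end PhysHermiteRecurrence

section ContourIntegral

open scoped Topology

/-- The integrand `z ^ n * exp ((z - x) ^ 2)` at the point `z = a + ρ (1 + 2i)`. -/
noncomputable def hermiteKernel (n : ℕ) (a x ρ : ℝ) : ℂ :=
  ((a : ℂ) + ρ * (1 + 2 * Complex.I)) ^ n *
    Complex.exp (((a : ℂ) + ρ * (1 + 2 * Complex.I) - x) ^ 2)

/-- The integral of `z ^ n * exp ((z - x) ^ 2)` along the ray from `a` in direction `1 + 2i`. -/
noncomputable def hermiteContour (n : ℕ) (a x : ℝ) : ℂ :=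
  ∫ ρ in Set.Ioi (0 : ℝ), hermiteKernel n a x ρ * (1 + 2 * Complex.I)

theorem norm_hermiteKernel (n : ℕ) (a x ρ : ℝ) :
    ‖hermiteKernel n a x ρ‖ =
      ‖(a : ℂ) + ρ * (1 + 2 * Complex.I)‖ ^ n *
        Real.exp ((a - x) ^ 2 + 2 * ρ * (a - x) - 3 * ρ ^ 2) := by
  rw [hermiteKernel, norm_mul, norm_pow, Complex.norm_exp]
  congr 2
  simp [pow_two]
  ring

theorem norm_hermiteKernel_le (n : ℕ) {R a x ρ : ℝ} (ha : |a| ≤ R) (hx : |x| ≤ R) (hρ : 0 ≤ ρ) :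
    ‖hermiteKernel n a x ρ‖ ≤
      Real.exp (n * R + 4 * R ^ 2 + (3 * n + 4 * R + 1) ^ 2) * Real.exp (-1 * ρ) := by
  have h1 : ‖(a : ℂ) + ρ * (1 + 2 * Complex.I)‖ ≤ Real.exp (R + 3 * ρ) := by
    have h2 : ‖(1 + 2 * Complex.I : ℂ)‖ ≤ 3 := by
      refine (norm_add_le _ _).trans ?_
      norm_num
    calc ‖(a : ℂ) + ρ * (1 + 2 * Complex.I)‖ ≤ ‖(a : ℂ)‖ + ‖(ρ : ℂ) * (1 + 2 * Complex.I)‖ :=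
          norm_add_le _ _
      _ ≤ R + 3 * ρ := by
          rw [norm_mul, Complex.norm_real, Complex.norm_real, Real.norm_eq_abs, Real.norm_eq_abs,
            abs_of_nonneg hρ]
          nlinarith
      _ ≤ Real.exp (R + 3 * ρ) := by linarith [Real.add_one_le_exp (R + 3 * ρ)]
  rw [norm_hermiteKernel]
  calc _ ≤ Real.exp (R + 3 * ρ) ^ n * Real.exp ((a - x) ^ 2 + 2 * ρ * (a - x) - 3 * ρ ^ 2) := by
        gcongr
    _ ≤ _ := by
        rw [← Real.exp_nat_mul, ← Real.exp_add, ← Real.exp_add, Real.exp_le_exp]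
        have ha' := abs_le.1 ha
        have hx' := abs_le.1 hx
        have h3 : (a - x) ^ 2 ≤ (2 * R) ^ 2 := sq_le_sq' (by linarith) (by linarith)
        have h4 : ρ * (a - x) ≤ ρ * (2 * R) := by gcongr; linarith
        nlinarith [sq_nonneg (ρ - (3 * n + 4 * R + 1)), sq_nonneg (3 * n + 4 * R + 1 : ℝ),
          sq_nonneg ρ]

theorem continuous_hermiteKernel (n : ℕ) (a x : ℝ) : Continuous (hermiteKernel n a x) := by
  unfold hermiteKernel
  fun_prop

theorem integrableOn_hermiteKernel (n : ℕ) (a x : ℝ) :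
    IntegrableOn (hermiteKernel n a x) (Set.Ioi 0) := by
  refine Integrable.mono' ((integrableOn_exp_mul_Ioi neg_one_lt_zero 0).const_mul
      (Real.exp (n * max |a| |x| + 4 * max |a| |x| ^ 2 + (3 * n + 4 * max |a| |x| + 1) ^ 2)))
    (continuous_hermiteKernel n a x).aestronglyMeasurable ?_
  filter_upwards [ae_restrict_mem measurableSet_Ioi] with ρ hρ
  exact norm_hermiteKernel_le n (le_max_left |a| |x|) (le_max_right |a| |x|) (le_of_lt hρ)

theorem tendsto_hermiteKernel (n : ℕ) (a x : ℝ) :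
    Tendsto (hermiteKernel n a x) atTop (𝓝 0) := by
  have h : Tendsto (fun ρ : ℝ => Real.exp (n * max |a| |x| + 4 * max |a| |x| ^ 2 +
      (3 * n + 4 * max |a| |x| + 1) ^ 2) * Real.exp (-1 * ρ)) atTop (𝓝 0) := by
    simpa using (Real.tendsto_exp_neg_atTop_nhds_zero).const_mul
      (Real.exp (n * max |a| |x| + 4 * max |a| |x| ^ 2 + (3 * n + 4 * max |a| |x| + 1) ^ 2))
  refine squeeze_zero_norm' ?_ h
  filter_upwards [eventually_ge_atTop 0] with ρ hρ
  exact norm_hermiteKernel_le n (le_max_left |a| |x|) (le_max_right |a| |x|) hρ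

theorem hasDerivAt_pow_mul_exp_sq (n : ℕ) (z x : ℂ) :
    HasDerivAt (fun z : ℂ => z ^ n * Complex.exp ((z - x) ^ 2))
      (n * (z ^ (n - 1) * Complex.exp ((z - x) ^ 2)) +
        2 * (z ^ (n + 1) * Complex.exp ((z - x) ^ 2)) -
        2 * x * (z ^ n * Complex.exp ((z - x) ^ 2))) z := by
  have h := (hasDerivAt_pow n z).mul ((((hasDerivAt_id z).sub_const x).pow 2).cexp)
  refine h.congr_deriv ?_
  simp
  ring

theorem hasDerivAt_hermiteKernel (n : ℕ) (a x ρ : ℝ) :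
    HasDerivAt (hermiteKernel n a x)
      ((n * hermiteKernel (n - 1) a x ρ + 2 * hermiteKernel (n + 1) a x ρ -
        2 * x * hermiteKernel n a x ρ) * (1 + 2 * Complex.I)) ρ := by
  have h1 : HasDerivAt (fun ρ : ℝ => (a : ℂ) + ρ * (1 + 2 * Complex.I))
      (1 + 2 * Complex.I) ρ := by
    simpa using ((hasDerivAt_id ρ).ofReal_comp.mul_const (1 + 2 * Complex.I)).const_add (a : ℂ)
  exact (hasDerivAt_pow_mul_exp_sq n ((a : ℂ) + ρ * (1 + 2 * Complex.I)) x).comp ρ h1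

theorem hasDerivAt_hermiteKernel_base (n : ℕ) (a x ρ : ℝ) :
    HasDerivAt (fun a => hermiteKernel n a x ρ)
      (n * hermiteKernel (n - 1) a x ρ + 2 * hermiteKernel (n + 1) a x ρ -
        2 * x * hermiteKernel n a x ρ) a := by
  have h1 : HasDerivAt (fun a : ℝ => (a : ℂ) + ρ * (1 + 2 * Complex.I)) 1 a := by
    simpa using (hasDerivAt_id a).ofReal_comp.add_const ((ρ : ℂ) * (1 + 2 * Complex.I))
  have h := (hasDerivAt_pow_mul_exp_sq n ((a : ℂ) + ρ * (1 + 2 * Complex.I)) x).comp a h1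
  rw [mul_one] at h
  exact h

theorem integral_deriv_hermiteKernel (n : ℕ) (a x : ℝ) :
    ∫ ρ in Set.Ioi (0 : ℝ), (n * hermiteKernel (n - 1) a x ρ + 2 * hermiteKernel (n + 1) a x ρ -
        2 * x * hermiteKernel n a x ρ) * (1 + 2 * Complex.I) =
      -((a ^ n * Real.exp ((a - x) ^ 2) : ℝ) : ℂ) := by
  rw [integral_Ioi_of_hasDerivAt_of_tendsto' (fun ρ _ => hasDerivAt_hermiteKernel n a x ρ) ?_
    (tendsto_hermiteKernel n a x)]
  · simp [hermiteKernel]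
  · exact ((((integrableOn_hermiteKernel (n - 1) a x).const_mul _).add
      ((integrableOn_hermiteKernel (n + 1) a x).const_mul _)).sub
      ((integrableOn_hermiteKernel n a x).const_mul _)).mul_const _

theorem hermiteContour_recurrence (n : ℕ) (a x : ℝ) :
    n * hermiteContour (n - 1) a x + 2 * hermiteContour (n + 1) a x -
        2 * x * hermiteContour n a x =
      -((a ^ n * Real.exp ((a - x) ^ 2) : ℝ) : ℂ) := by
  have hi (m : ℕ) : Integrable (fun ρ => hermiteKernel m a x ρ * (1 + 2 * Complex.I))
    (volume.restrict (Set.Ioi 0)) := (integrableOn_hermiteKernel m a x).mul_const _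
  rw [← integral_deriv_hermiteKernel]
  simp only [hermiteContour, ← integral_const_mul]
  rw [← integral_add ((hi _).const_mul _) ((hi _).const_mul _)]
  refine (integral_sub (((hi _).const_mul _).add ((hi _).const_mul _))
    ((hi _).const_mul _)).symm.trans ?_
  congr 1
  ext ρ
  simp only [Pi.add_apply]
  ring

theorem hasDerivAt_hermiteContour_zero (a x : ℝ) :
    HasDerivAt (fun a => hermiteContour 0 a x) (-(Real.exp ((a - x) ^ 2) : ℂ)) a := by
  have h0 := integral_deriv_hermiteKernel 0 a x
  simp only [pow_zero, one_mul] at h0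
  rw [← h0]
  set R := max (|a| + 1) |x| with hR
  have hxR : |x| ≤ R := le_max_right _ _
  refine (hasDerivAt_integral_of_dominated_loc_of_deriv_le (Metric.ball_mem_nhds a one_pos)
    (.of_forall fun b => ((continuous_hermiteKernel 0 b x).mul_const _).aestronglyMeasurable)
    ((integrableOn_hermiteKernel 0 a x).mul_const _)
    (F' := fun a ρ => (((0 : ℕ) : ℂ) * hermiteKernel (0 - 1) a x ρ +
      2 * hermiteKernel (0 + 1) a x ρ - 2 * x * hermiteKernel 0 a x ρ) * (1 + 2 * Complex.I))
    (bound := fun ρ => (2 * (Real.exp ((1 : ℕ) * R + 4 * R ^ 2 + (3 * (1 : ℕ) + 4 * R + 1) ^ 2) *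
        Real.exp (-1 * ρ)) + 2 * R *
        (Real.exp ((0 : ℕ) * R + 4 * R ^ 2 + (3 * (0 : ℕ) + 4 * R + 1) ^ 2) *
        Real.exp (-1 * ρ))) * ‖(1 + 2 * Complex.I : ℂ)‖) ?_ ?_ ?_ ?_).2
  · refine Continuous.aestronglyMeasurable ?_
    have h1 := continuous_hermiteKernel 1 a x
    have h2 := continuous_hermiteKernel 0 a x
    simp only [zero_add, zero_tsub]
    fun_prop
  · filter_upwards [ae_restrict_mem measurableSet_Ioi] with ρ hρ b hb
    have hbR : |b| ≤ R := by
      refine le_trans ?_ (le_max_left _ _)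
      rw [Metric.mem_ball, Real.dist_eq] at hb
      linarith [abs_sub_abs_le_abs_sub b a]
    have k1 := norm_hermiteKernel_le 1 hbR hxR (le_of_lt hρ)
    have k0 := norm_hermiteKernel_le 0 hbR hxR (le_of_lt hρ)
    rw [norm_mul]
    gcongr
    simp only [Nat.cast_zero, zero_mul, zero_add]
    refine (norm_sub_le _ _).trans (add_le_add ?_ ?_)
    · rw [norm_mul, Complex.norm_ofNat]
      simpa using mul_le_mul_of_nonneg_left k1 zero_le_two
    · rw [norm_mul, norm_mul, Complex.norm_ofNat, Complex.norm_real, Real.norm_eq_abs]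
      have hR0 : 0 ≤ R := (abs_nonneg x).trans hxR
      have k0' := mul_le_mul (mul_le_mul_of_nonneg_left hxR zero_le_two) k0 (norm_nonneg _)
        (by positivity)
      simpa using k0'
  · exact ((((integrableOn_exp_mul_Ioi neg_one_lt_zero 0).const_mul _).const_mul _).add
      (((integrableOn_exp_mul_Ioi neg_one_lt_zero 0).const_mul _).const_mul _)).mul_const _
  · filter_upwards with ρ b _
    exact (hasDerivAt_hermiteKernel_base 0 b x ρ).mul_const _

theorem im_hermiteContour_zero_self (x : ℝ) : (hermiteContour 0 x x).im = √π / 2 := by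
  have h3 : (3 - 4 * Complex.I : ℂ) = -(1 + 2 * Complex.I) ^ 2 := by
    linear_combination 4 * Complex.I_sq
  have h1 : hermiteContour 0 x x =
      (∫ ρ : ℝ in Set.Ioi 0, Complex.exp (-(3 - 4 * Complex.I) * (ρ : ℂ) ^ 2)) *
        (1 + 2 * Complex.I) := by
    rw [← integral_mul_const, hermiteContour]
    congr 1
    ext ρ
    simp only [hermiteKernel, pow_zero, one_mul, h3]
    ring_nf
  have hne : (1 + 2 * Complex.I : ℂ) ≠ 0 := by
    intro h
    simpa using congrArg Complex.re h
  have h2 : (π / (3 - 4 * Complex.I) : ℂ) = ((√π : ℂ) * ((2 + Complex.I) / 5)) ^ 2 := by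
    have hpi : (√π : ℂ) ^ 2 = π := by
      rw [← Complex.ofReal_pow, Real.sq_sqrt Real.pi_pos.le]
    rw [h3, mul_pow, hpi, div_eq_iff (neg_ne_zero.2 (pow_ne_zero 2 hne))]
    have hI : Complex.I ^ 4 = 1 := Complex.I_pow_four
    have hI3 : Complex.I ^ 3 = -Complex.I := Complex.I_pow_three
    ring_nf
    rw [hI, hI3, Complex.I_sq]
    ring
  rw [h1, integral_gaussian_complex_Ioi (by simp), h2, one_div, Complex.sq_cpow_two_inv]
  · simp
    ring
  · simp [Real.pi_pos]

theorem im_hermiteContour_zero (a x : ℝ) : (hermiteContour 0 a x).im = √π / 2 := by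
  have hd (b : ℝ) : HasDerivAt (fun a => (hermiteContour 0 a x).im) 0 b := by
    have h := Complex.imCLM.hasFDerivAt.comp_hasDerivAt b (hasDerivAt_hermiteContour_zero b x)
    rw [Complex.imCLM_apply, Complex.neg_im, Complex.ofReal_im, neg_zero] at h
    exact h
  rw [← im_hermiteContour_zero_self x]
  exact is_const_of_deriv_eq_zero (fun b => (hd b).differentiableAt) (fun b => (hd b).deriv) a x

/-- Contour integral representation of the Hermite polynomials. -/
theorem physHermite_eq_im_hermiteContour (n : ℕ) (a x : ℝ) :
    physHermite n x = 2 ^ (n + 1) / √π * (hermiteContour n a x).im := by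
  have hpi : √π ≠ 0 := (Real.sqrt_pos.2 Real.pi_pos).ne'
  have hrec (n : ℕ) : n * (hermiteContour (n - 1) a x).im + 2 * (hermiteContour (n + 1) a x).im -
      2 * x * (hermiteContour n a x).im = 0 := by
    have h := congrArg Complex.im (hermiteContour_recurrence n a x)
    simpa [-Complex.ofReal_mul, -Complex.ofReal_pow, -Complex.ofReal_exp] using h
  induction n using Nat.twoStepInduction with
  | zero => rw [physHermite_zero, im_hermiteContour_zero]; field_simp; norm_num
  | one =>
    have h := hrec 0
    rw [im_hermiteContour_zero] at h
    have h' : (hermiteContour 1 a x).im = x * √π / 2 := by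
      simp only [Nat.cast_zero, zero_add, zero_mul] at h
      linarith
    rw [physHermite_one, h']
    field_simp
    ring
  | more n ih1 ih2 =>
    have h := hrec (n + 1)
    simp only [Nat.add_sub_cancel] at h
    push_cast at h
    rw [physHermite_add_two, ih1, ih2]
    linear_combination (-(2 ^ (n + 2) / √π)) * h

end ContourIntegral

section KernelEstimate

theorem log_one_add_two_mul_add_five_mul_sq_le {v : ℝ} (hv : 0 ≤ v) :
    Real.log (1 + 2 * v + 5 * v ^ 2) ≤ 2 * v + 3 * v ^ 2 - 2 * v ^ 3 / (3 * (1 + v)) := by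
  let f : ℝ → ℝ := fun v =>
    2 * v + 3 * v ^ 2 - 2 * v ^ 3 / (3 * (1 + v)) - Real.log (1 + 2 * v + 5 * v ^ 2)
  have hd (v : ℝ) (hv : 0 ≤ v) : HasDerivAt f
      (2 + 3 * (2 * v) - (2 * (3 * v ^ 2) * (3 * (1 + v)) - 2 * v ^ 3 * 3) / (3 * (1 + v)) ^ 2 -
        (2 + 5 * (2 * v)) / (1 + 2 * v + 5 * v ^ 2)) v := by
    have hid := hasDerivAt_id v
    have h1 := (hid.const_mul 2).add ((hid.pow 2).const_mul 3)
    have h2 := ((hid.pow 3).const_mul 2).div ((hid.const_add 1).const_mul 3)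
      (by simp only [id]; positivity)
    have h3 := (((hid.const_mul 2).const_add 1).add ((hid.pow 2).const_mul 5)).log
      (by simp only [id, Pi.add_apply, Pi.pow_apply]; positivity)
    refine ((h1.sub h2).sub h3).congr_deriv ?_
    simp
  have hmono : MonotoneOn f (Set.Ici 0) := by
    refine monotoneOn_of_deriv_nonneg (convex_Ici 0)
      (fun v hv => (hd v hv).continuousAt.continuousWithinAt)
      (fun v hv => (hd v (interior_subset hv)).differentiableAt.differentiableWithinAt) ?_
    intro v hv
    have hv0 : 0 ≤ v := interior_subset hv
    rw [(hd v hv0).deriv]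
    have h : 2 + 3 * (2 * v) - (2 * (3 * v ^ 2) * (3 * (1 + v)) - 2 * v ^ 3 * 3) /
        (3 * (1 + v)) ^ 2 - (2 + 5 * (2 * v)) / (1 + 2 * v + 5 * v ^ 2) =
        (60 * v ^ 2 + 206 * v ^ 3 + 208 * v ^ 4 + 70 * v ^ 5) /
          (3 * (1 + v) ^ 2 * (1 + 2 * v + 5 * v ^ 2)) := by
      have : 1 + 2 * v + 5 * v ^ 2 ≠ 0 := by positivity
      have : 1 + v ≠ 0 := by positivity
      field_simp
      ring
    rw [h]
    positivity
  have h := hmono (Set.mem_Ici.2 le_rfl) (Set.mem_Ici.2 hv) hv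
  simp only [f] at h
  norm_num at h
  linarith

theorem one_add_two_mul_add_five_mul_sq_le_exp {t v : ℝ} (ht : 0 ≤ t) (ht1 : t ≤ 1)
    (hv : 0 ≤ v) :
    1 + 2 * v + 5 * v ^ 2 ≤ Real.exp (2 * v + 3 * v ^ 2 - t ^ 2 / 3 * (v - t)) := by
  rw [← Real.log_le_iff_le_exp (by positivity)]
  refine (log_one_add_two_mul_add_five_mul_sq_le hv).trans ?_
  have h : t ^ 2 / 3 * (v - t) ≤ 2 * v ^ 3 / (3 * (1 + v)) := by
    rw [le_div_iff₀ (by positivity)]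
    rcases le_total v t with hvt | hvt
    · have h1 : t ^ 2 / 3 * (v - t) * (3 * (1 + v)) ≤ 0 :=
        mul_nonpos_of_nonpos_of_nonneg
          (mul_nonpos_of_nonneg_of_nonpos (by positivity) (by linarith)) (by positivity)
      exact h1.trans (by positivity)
    · have h1 : t ^ 2 ≤ v ^ 2 := by gcongr
      have h2 : t ^ 2 ≤ v := by nlinarith
      have h3 : t ^ 2 * v ≤ v ^ 2 * v := by gcongr
      have h4 : t ^ 2 * v ^ 2 ≤ v * v ^ 2 := by gcongr
      have h5 : 0 ≤ t ^ 3 * (1 + v) := by positivity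
      linarith
  linarith

theorem norm_add_mul_one_add_two_I_le {a ρ t : ℝ} (ha : 0 < a) (hρ : 0 ≤ ρ) (ht : 0 ≤ t)
    (ht1 : t ≤ 1) :
    ‖(a : ℂ) + ρ * (1 + 2 * Complex.I)‖ ≤
      a * Real.exp (ρ / a + 3 / 2 * (ρ / a) ^ 2 - t ^ 2 / 6 * (ρ / a - t)) := by
  rw [← pow_le_pow_iff_left₀ (norm_nonneg _) (by positivity) two_ne_zero, mul_pow,
    ← Real.exp_nat_mul, ← Complex.normSq_eq_norm_sq]
  have h1 : Complex.normSq ((a : ℂ) + ρ * (1 + 2 * Complex.I)) =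
      a ^ 2 * (1 + 2 * (ρ / a) + 5 * (ρ / a) ^ 2) := by
    simp [Complex.normSq_apply]
    field_simp
    ring
  rw [h1]
  have h2 := one_add_two_mul_add_five_mul_sq_le_exp ht ht1 (div_nonneg hρ ha.le)
  refine mul_le_mul_of_nonneg_left (h2.trans_eq ?_) (by positivity)
  congr 1
  push_cast
  ring

theorem norm_hermiteKernel_le_of_scale {n : ℕ} {a x ρ q K T : ℝ} (ha : 0 < a) (hρ : 0 ≤ ρ)
    (hq : 0 < q) (hqn : q ^ 3 ≤ 2 * n) (hT : 0 ≤ T) (hTq : T ≤ q) (hKT : K + 1 ≤ T ^ 2 / 12)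
    (hna : n ≤ 2 * a ^ 2) (hx : n + 2 * a * (a - x) ≤ K * q) :
    ‖hermiteKernel n a x ρ‖ ≤
      a ^ n * Real.exp ((a - x) ^ 2 + n / q ^ 3 * T ^ 3 / 6) * Real.exp (-(q / a) * ρ) := by
  rw [norm_hermiteKernel]
  calc _ ≤ (a * Real.exp (ρ / a + 3 / 2 * (ρ / a) ^ 2 -
          (T / q) ^ 2 / 6 * (ρ / a - T / q))) ^ n *
          Real.exp ((a - x) ^ 2 + 2 * ρ * (a - x) - 3 * ρ ^ 2) := by
        gcongr
        exact norm_add_mul_one_add_two_I_le ha hρ (by positivity) ((div_le_one hq).2 hTq)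
    _ ≤ _ := by
        rw [mul_pow, ← Real.exp_nat_mul, mul_assoc (a ^ n), mul_assoc (a ^ n), ← Real.exp_add,
          ← Real.exp_add]
        refine mul_le_mul_of_nonneg_left (Real.exp_le_exp.2 ?_) (by positivity)
        obtain ⟨v, hv, rfl⟩ : ∃ v, 0 ≤ v ∧ ρ = a * v :=
          ⟨ρ / a, by positivity, by field_simp⟩
        have h0 : a * v / a = v := by field_simp
        have h1 : -(q / a) * (a * v) = -(q * v) := by field_simp
        rw [h0, h1]
        have h2 : v * (n + 2 * a * (a - x)) ≤ v * (K * q) := by gcongr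
        have h3 : (n : ℝ) * v ^ 2 ≤ 2 * a ^ 2 * v ^ 2 := by gcongr
        have h4 : v * (K * q) + v * q ≤ v * (n * (T / q) ^ 2 / 6) := by
          have h5 : (K + 1) * q ≤ n * (T / q) ^ 2 / 6 := by
            rw [div_pow]
            calc (K + 1) * q ≤ T ^ 2 / 12 * q := by gcongr
              _ = q ^ 3 * T ^ 2 / (12 * q ^ 2) := by field_simp
              _ ≤ 2 * n * T ^ 2 / (12 * q ^ 2) := by gcongr
              _ = _ := by field_simp; ring
          calc _ = v * ((K + 1) * q) := by ring
            _ ≤ _ := by gcongr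
        have h6 : n / q ^ 3 * T ^ 3 / 6 = n * (T / q) ^ 3 / 6 := by field_simp
        rw [h6]
        linarith

theorem norm_hermiteContour_le {n : ℕ} {a x q K T : ℝ} (ha : 0 < a)
    (hq : 0 < q) (hqn : q ^ 3 ≤ 2 * n) (hT : 0 ≤ T) (hTq : T ≤ q) (hKT : K + 1 ≤ T ^ 2 / 12)
    (hna : n ≤ 2 * a ^ 2) (hx : n + 2 * a * (a - x) ≤ K * q) :
    ‖hermiteContour n a x‖ ≤
      3 * a ^ (n + 1) * Real.exp ((a - x) ^ 2 + n / q ^ 3 * T ^ 3 / 6) / q := by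
  set B := a ^ n * Real.exp ((a - x) ^ 2 + n / q ^ 3 * T ^ 3 / 6) with hB
  have hneg : -(q / a) < 0 := by simp; positivity
  have hω : ‖(1 + 2 * Complex.I : ℂ)‖ ≤ 3 := by
    refine (norm_add_le _ _).trans ?_
    norm_num
  have h : ‖hermiteContour n a x‖ ≤
      ∫ ρ in Set.Ioi (0 : ℝ), B * Real.exp (-(q / a) * ρ) * 3 := by
    refine norm_integral_le_of_norm_le
      (((integrableOn_exp_mul_Ioi hneg 0).const_mul B).mul_const 3) ?_
    filter_upwards [ae_restrict_mem measurableSet_Ioi] with ρ hρ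
    rw [norm_mul]
    gcongr
    exact norm_hermiteKernel_le_of_scale ha (le_of_lt hρ) hq hqn hT hTq hKT hna hx
  refine h.trans_eq ?_
  rw [integral_mul_const, integral_const_mul, integral_exp_mul_Ioi hneg, hB]
  simp only [mul_zero, Real.exp_zero]
  field_simp
  ring

end KernelEstimate

section TurningPoint

theorem log_one_add_le_cubic {y : ℝ} (hy : 0 ≤ y) :
    Real.log (1 + y) ≤ y - y ^ 2 / 2 + y ^ 3 / 3 := by
  let f : ℝ → ℝ := fun y => y - y ^ 2 / 2 + y ^ 3 / 3 - Real.log (1 + y)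
  have hd (y : ℝ) (hy : 0 ≤ y) : HasDerivAt f (1 - 2 * y / 2 + 3 * y ^ 2 / 3 - 1 / (1 + y)) y := by
    have hid := hasDerivAt_id y
    refine (((hid.sub ((hid.pow 2).div_const 2)).add ((hid.pow 3).div_const 3)).sub
      ((hid.const_add 1).log (by simp only [id]; positivity))).congr_deriv ?_
    simp
  have hmono : MonotoneOn f (Set.Ici 0) := by
    refine monotoneOn_of_deriv_nonneg (convex_Ici 0)
      (fun v hv => (hd v hv).continuousAt.continuousWithinAt)
      (fun v hv => (hd v (interior_subset hv)).differentiableAt.differentiableWithinAt) ?_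
    intro v hv
    have hv0 : 0 ≤ v := interior_subset hv
    rw [(hd v hv0).deriv]
    have h : 1 - 2 * v / 2 + 3 * v ^ 2 / 3 - 1 / (1 + v) = v ^ 3 / (1 + v) := by
      have : 1 + v ≠ 0 := by positivity
      field_simp
      ring
    rw [h]
    positivity
  have h := hmono (Set.mem_Ici.2 le_rfl) (Set.mem_Ici.2 hy) hy
  simp only [f] at h
  norm_num at h
  linarith

/-- The exponent governing the size of the contour integral, with the contour based at
`x / 2 + δ`, where `2 b = √(2 n)` is the turning point. -/
theorem exponent_le {b δ x m : ℝ} (hb : 0 < b) (hδ : 0 ≤ δ) (ha : 0 < x / 2 + δ) (hm : 0 ≤ m)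
    (hx : -m ≤ x / 2 - b) :
    2 * b ^ 2 * Real.log ((x / 2 + δ) / b) + b ^ 2 + (x / 2 + δ - x) ^ 2 - x ^ 2 / 2 ≤
      2 * δ ^ 3 / (3 * b) + 2 * δ * m - 2 * δ * (x / 2 - b) := by
  obtain ⟨y, hy, rfl⟩ : ∃ y, 0 ≤ y ∧ δ = b * y := ⟨δ / b, by positivity, by field_simp⟩
  obtain ⟨e, rfl⟩ : ∃ e, x = 2 * b + 2 * e := ⟨x / 2 - b, by ring⟩
  have hy1 : 0 < 1 + y := by positivity
  have he : (2 * b + 2 * e) / 2 - b = e := by ring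
  have hae : (2 * b + 2 * e) / 2 + b * y = b * (1 + y) + e := by ring
  rw [he] at hx ⊢
  rw [hae] at ha ⊢
  have h1 : Real.log ((b * (1 + y) + e) / b) ≤ y - y ^ 2 / 2 + y ^ 3 / 3 + e / (b * (1 + y)) := by
    have h2 : (b * (1 + y) + e) / b = (1 + y) * ((b * (1 + y) + e) / (b * (1 + y))) := by
      field_simp
    rw [h2, Real.log_mul hy1.ne' (by positivity)]
    refine add_le_add (log_one_add_le_cubic hy) ((Real.log_le_sub_one_of_pos
      (by positivity)).trans_eq ?_)
    field_simp
    ring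
  have h3 : 2 * b ^ 2 * Real.log ((b * (1 + y) + e) / b) ≤
      2 * b ^ 2 * (y - y ^ 2 / 2 + y ^ 3 / 3 + e / (b * (1 + y))) := by gcongr
  have h4 : 2 * b ^ 2 * (e / (b * (1 + y))) = 2 * b * e - 2 * b * y * e * (1 / (1 + y)) := by
    field_simp
    ring
  have h5 : 2 * (b * y) ^ 3 / (3 * b) = 2 * b ^ 2 * y ^ 3 / 3 := by field_simp
  have h6 : 0 ≤ 2 * b * y * (m + e * (1 / (1 + y))) := by
    have h7 : 1 / (1 + y) ≤ 1 := (div_le_one hy1).2 (by linarith)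
    have h8 : 0 ≤ 1 / (1 + y) := by positivity
    have h9 : 0 ≤ m + e * (1 / (1 + y)) := by nlinarith
    positivity
  rw [h5]
  nlinarith [sq_nonneg e]

end TurningPoint

section OscillatorEstimate

theorem hNorm_pos (n : ℕ) : 0 < hNorm n := by
  have := Real.pi_pos
  unfold hNorm
  positivity

theorem tauN_pos {N : ℕ} (hN : 0 < N) : 0 < tauN N := by
  unfold tauN
  positivity

theorem tauN_sq_mul {N : ℕ} (hN : 0 < N) :
    tauN N ^ 2 * ((N : ℝ) ^ ((1 : ℝ) / 6)) ^ 2 = 1 / 2 := by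
  have hN' : (0 : ℝ) < N := by exact_mod_cast hN
  have h1 : (N : ℝ) ^ (-(1 : ℝ) / 6) * (N : ℝ) ^ ((1 : ℝ) / 6) = 1 := by
    rw [← Real.rpow_add hN']
    norm_num
  have h2 : ((2 : ℝ) ^ (-(1 : ℝ) / 2)) ^ 2 = 1 / 2 := by
    rw [← Real.rpow_natCast, ← Real.rpow_mul zero_le_two]
    norm_num [Real.rpow_neg_one]
  rw [← mul_pow, tauN, mul_assoc, h1, mul_one, h2]

/-- Stirling's lower bound for the normalizing constant. -/
theorem le_hNorm (n : ℕ) :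
    2 * √n * 2 ^ n * (n / Real.exp 1) ^ n ≤ hNorm n := by
  have h : 2 * √n ≤ √π * √(2 * π * n) := by
    rw [← Real.sqrt_mul Real.pi_pos.le, Real.le_sqrt (by positivity) (by positivity), mul_pow,
      Real.sq_sqrt (by positivity)]
    have h3 : (2 : ℝ) ≤ π ^ 2 := by nlinarith [Real.pi_gt_three]
    nlinarith [mul_le_mul_of_nonneg_right h3 (Nat.cast_nonneg (α := ℝ) n)]
  calc 2 * √n * 2 ^ n * (n / Real.exp 1) ^ n
      ≤ √π * √(2 * π * n) * 2 ^ n * (n / Real.exp 1) ^ n := by gcongr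
    _ = √π * 2 ^ n * (√(2 * π * n) * (n / Real.exp 1) ^ n) := by ring
    _ ≤ hNorm n := by
      unfold hNorm
      gcongr
      exact Stirling.le_factorial_stirling n

theorem prefactor_le {n N : ℕ} {b : ℝ} (hn : 0 < n) (hN : 0 < N) (hNn : N ≤ 2 * n)
    (hb : 0 < b) (hbn : 2 * b ^ 2 = n) :
    (2 * N : ℝ) ^ ((1 : ℝ) / 4) * tauN N * hNorm n ^ (-(1 : ℝ) / 2) * 2 ^ n ≤
      Real.exp (b ^ 2) / (b ^ n * (N : ℝ) ^ ((1 : ℝ) / 6)) := by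
  have hn' : (0 : ℝ) < n := by exact_mod_cast hn
  have hN' : (0 : ℝ) < N := by exact_mod_cast hN
  have hNn' : (N : ℝ) ≤ 2 * n := by exact_mod_cast hNn
  have hτ := tauN_pos hN
  have hh := hNorm_pos n
  set p := (N : ℝ) ^ ((1 : ℝ) / 6) with hp
  have hp0 : 0 < p := by positivity
  have h1 : ((2 * N : ℝ) ^ ((1 : ℝ) / 4)) ^ 2 ≤ 2 * √n := by
    rw [← Real.rpow_natCast, ← Real.rpow_mul (by positivity)]
    have : (2 * N : ℝ) ^ ((1 : ℝ) / 4 * (2 : ℕ)) = √(2 * N) := by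
      rw [Real.sqrt_eq_rpow]
      norm_num
    rw [this, Real.sqrt_le_left (by positivity), mul_pow, Real.sq_sqrt (by positivity)]
    linarith
  have h2 : (hNorm n ^ (-(1 : ℝ) / 2)) ^ 2 = (hNorm n)⁻¹ := by
    rw [← Real.rpow_natCast, ← Real.rpow_mul hh.le]
    norm_num [Real.rpow_neg_one]
  have h3 : tauN N ^ 2 = 1 / (2 * p ^ 2) := by
    have := tauN_sq_mul hN
    rw [← hp] at this
    field_simp
    linarith
  have h4 : (hNorm n)⁻¹ ≤ (2 * √n * 2 ^ n * (n / Real.exp 1) ^ n)⁻¹ := by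
    have : 0 < √(n : ℝ) := Real.sqrt_pos.2 hn'
    exact inv_anti₀ (by positivity) (le_hNorm n)
  rw [← pow_le_pow_iff_left₀ (by positivity) (by positivity) two_ne_zero]
  have hsn : 0 < √(n : ℝ) := Real.sqrt_pos.2 hn'
  calc _ = ((2 * N : ℝ) ^ ((1 : ℝ) / 4)) ^ 2 * tauN N ^ 2 * (hNorm n ^ (-(1 : ℝ) / 2)) ^ 2 *
        (2 ^ n) ^ 2 := by ring
    _ ≤ (2 * √n) * (1 / (2 * p ^ 2)) * (2 * √n * 2 ^ n * (n / Real.exp 1) ^ n)⁻¹ *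
        (2 ^ n) ^ 2 := by
      rw [h2, h3]
      gcongr
    _ = (1 / (2 * p ^ 2)) * (2 ^ n * Real.exp 1 ^ n / n ^ n) := by
      rw [div_pow]
      field_simp
    _ ≤ (1 / p ^ 2) * (2 ^ n * Real.exp 1 ^ n / n ^ n) := by
      gcongr
      linarith [sq_nonneg p]
    _ = _ := by
      have h5 : Real.exp (b ^ 2) ^ 2 = Real.exp 1 ^ n := by
        rw [← Real.exp_nat_mul, ← Real.exp_nat_mul, ← hbn]
        norm_num
      have h6 : (n : ℝ) ^ n = 2 ^ n * (b ^ n) ^ 2 := by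
        rw [← hbn, mul_pow]
        ring
      rw [div_pow, h5, h6, mul_pow]
      field_simp

/-- Saddle point bound for the rescaled wave function, with the contour based at `a`. -/
theorem abs_rescaled_osc_le {n N : ℕ} {a b x K T : ℝ} (hn : 0 < n) (hN : 0 < N)
    (hNn : N ≤ 2 * n) (hnN : n ≤ N) (hb : 0 < b) (hbn : 2 * b ^ 2 = n) (ha : b ≤ a) (hT : 0 ≤ T)
    (hTN : T ≤ ((N : ℝ) ^ ((1 : ℝ) / 6)) ^ 2) (hKT : K + 1 ≤ T ^ 2 / 12)
    (hx : n + 2 * a * (a - x) ≤ K * ((N : ℝ) ^ ((1 : ℝ) / 6)) ^ 2) :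
    |(2 * N : ℝ) ^ ((1 : ℝ) / 4) * tauN N * osc n x| ≤
      6 * Real.exp (T ^ 3 / 6) * (a / ((N : ℝ) ^ ((1 : ℝ) / 6)) ^ 3) *
        Real.exp (2 * b ^ 2 * Real.log (a / b) + b ^ 2 + (a - x) ^ 2 - x ^ 2 / 2) := by
  have hN' : (0 : ℝ) < N := by exact_mod_cast hN
  have hNn' : (N : ℝ) ≤ 2 * n := by exact_mod_cast hNn
  have hnN' : (n : ℝ) ≤ N := by exact_mod_cast hnN
  have hτ := tauN_pos hN
  have hpre := prefactor_le hn hN hNn hb hbn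
  have ha0 : 0 < a := hb.trans_le ha
  set p := (N : ℝ) ^ ((1 : ℝ) / 6) with hp
  have hp0 : 0 < p := by positivity
  have hp6 : (p ^ 2) ^ 3 = N := by
    rw [hp, ← pow_mul, ← Real.rpow_natCast, ← Real.rpow_mul hN'.le]
    norm_num
  have hI := norm_hermiteContour_le (n := n) ha0 (by positivity : 0 < p ^ 2)
    (by rw [hp6]; exact hNn') hT hTN hKT (by rw [← hbn]; gcongr) hx
  rw [hp6] at hI
  have hI2 : |(hermiteContour n a x).im| ≤
      3 * a ^ (n + 1) * Real.exp ((a - x) ^ 2 + T ^ 3 / 6) / p ^ 2 := by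
    refine ((Complex.abs_im_le_norm _).trans hI).trans ?_
    gcongr
    exact mul_le_of_le_one_left (by positivity) ((div_le_one hN').2 hnN')
  have hpi : 1 / √π ≤ 1 := by
    rw [div_le_one (Real.sqrt_pos.2 Real.pi_pos), Real.one_le_sqrt]
    linarith [Real.pi_gt_three]
  have hh := hNorm_pos n
  calc _ = ((2 * N : ℝ) ^ ((1 : ℝ) / 4) * tauN N * hNorm n ^ (-(1 : ℝ) / 2) * 2 ^ n) *
        (Real.exp (-x ^ 2 / 2) * (2 * (1 / √π) * |(hermiteContour n a x).im|)) := by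
        rw [osc, physHermite_eq_im_hermiteContour n a x]
        simp only [abs_mul, abs_div, abs_pow, Nat.abs_ofNat]
        rw [abs_of_pos hτ, abs_of_pos (Real.exp_pos _), abs_of_nonneg (Real.sqrt_nonneg π),
          abs_of_nonneg (by positivity : 0 ≤ (2 * N : ℝ) ^ ((1 : ℝ) / 4)),
          abs_of_nonneg (by positivity : 0 ≤ hNorm n ^ (-(1 : ℝ) / 2))]
        ring
    _ ≤ (Real.exp (b ^ 2) / (b ^ n * p)) * (Real.exp (-x ^ 2 / 2) * (2 * 1 *
        (3 * a ^ (n + 1) * Real.exp ((a - x) ^ 2 + T ^ 3 / 6) / p ^ 2))) := by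
        gcongr
    _ = 6 * Real.exp (T ^ 3 / 6) * (a / p ^ 3) * ((a / b) ^ n * Real.exp (b ^ 2) *
        Real.exp ((a - x) ^ 2) * Real.exp (-x ^ 2 / 2)) := by
        rw [Real.exp_add, div_pow]
        field_simp
        ring
    _ = _ := by
        have h : (a / b) ^ n = Real.exp (2 * b ^ 2 * Real.log (a / b)) := by
          rw [hbn, Real.exp_nat_mul, Real.exp_log (by positivity)]
        rw [h, ← Real.exp_add, ← Real.exp_add, ← Real.exp_add]
        congr 2
        ring

theorem linear_exponent_le {κ m s r : ℝ} (hm : 0 ≤ m) (hs : -m ≤ s) (hκ : 4 ≤ κ)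
    (hr : 1 / 2 ≤ r) (hr1 : r ≤ 1) : 2 * (κ * m) * r - κ * s * r ≤ 3 * κ * m - 2 * s := by
  have h1 : 0 ≤ κ * m := by positivity
  have h2 : κ * m * r ≤ κ * m * 1 := by gcongr
  have h3 : 2 * (s + m) ≤ κ * r * (s + m) := by
    refine mul_le_mul_of_nonneg_right ?_ (by linarith)
    nlinarith
  linarith

theorem sq_add_mul_ge {u s m τ p : ℝ} (hm : 0 ≤ m) (hs : -m ≤ s) (hτ : 0 ≤ τ)
    (hmu : m * τ ≤ u) (hu : u * τ ≤ 2 * p ^ 2) :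
    u ^ 2 - 4 * m * p ^ 2 ≤ (u + s * τ) ^ 2 := by
  have h1 : -m * τ ≤ s * τ := by gcongr
  have h2 : (u - m * τ) ^ 2 ≤ (u + s * τ) ^ 2 := by
    gcongr
    linarith
  nlinarith [mul_le_mul_of_nonneg_left hu hm, sq_nonneg (m * τ)]

theorem base_point_div_le {u s m τ p κ : ℝ} (hm : 0 ≤ m) (hs : -m ≤ s) (hτ : 0 ≤ τ) (hτ1 : τ ≤ 1)
    (hκ : 0 ≤ κ) (hp : 1 ≤ p) (hu : u ≤ 2 * p ^ 3) :
    ((u + s * τ) / 2 + κ * p) / p ^ 3 ≤ (1 + m + κ) * Real.exp (s + m) := by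
  have hsm : 0 ≤ s + m := by linarith
  have hp3 : 1 ≤ p ^ 3 := one_le_pow₀ hp
  have hpp : κ * p ≤ κ * p ^ 3 := by
    gcongr
    exact le_self_pow₀ hp (by norm_num)
  have h1 : s * τ ≤ (s + m) * p ^ 3 := by
    calc s * τ ≤ (s + m) * τ := by gcongr; linarith
      _ ≤ (s + m) * p ^ 3 := by gcongr; linarith
  have h2 : 0 ≤ (s + m) * p ^ 3 := by positivity
  have h3 : 1 + (s + m) + κ ≤ (1 + m + κ) * Real.exp (s + m) := by
    calc 1 + (s + m) + κ ≤ (1 + m + κ) * (s + m + 1) := by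
          nlinarith [mul_nonneg (add_nonneg hm hκ) hsm]
      _ ≤ _ := by
          gcongr
          exact Real.add_one_le_exp (s + m)
  rw [div_le_iff₀ (by linarith)]
  calc (u + s * τ) / 2 + κ * p ≤ (1 + (s + m) + κ) * p ^ 3 := by linarith
    _ ≤ _ := by gcongr

/-- The bound at `x = √(2 n + 1) + s τ`, with explicit constants depending only on `m ≥ -s`. -/
theorem abs_rescaled_osc_turning_point_le {n N : ℕ} {m s κ K T : ℝ} (hn : 0 < n) (hN : 0 < N)
    (hNn : N ≤ 2 * n) (hnN : n ≤ N) (hm : 0 ≤ m) (hs : -m ≤ s) (hκ : κ = 4 + m)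
    (hK : K = 2 * κ ^ 2 + 2 * m) (hT : T = 12 * (K + 1))
    (hTN : T + m + 2 ≤ (N : ℝ) ^ ((1 : ℝ) / 6)) :
    |(2 * N : ℝ) ^ ((1 : ℝ) / 4) * tauN N * osc n (√(2 * n + 1) + s * tauN N)| ≤
      6 * Real.exp (T ^ 3 / 6) * ((1 + m + κ) * Real.exp (s + m)) *
        Real.exp (2 * κ ^ 3 + 3 * κ * m - 2 * s) := by
  have hn' : (1 : ℝ) ≤ n := by exact_mod_cast hn
  have hN' : (1 : ℝ) ≤ N := by exact_mod_cast hN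
  have hNn' : (N : ℝ) ≤ 2 * n := by exact_mod_cast hNn
  have hnN' : (n : ℝ) ≤ N := by exact_mod_cast hnN
  have hτ := tauN_pos hN
  have hτp := tauN_sq_mul hN
  have hκ0 : 4 ≤ κ := by linarith
  have hK0 : 0 ≤ K := by rw [hK]; positivity
  have hT0 : 12 ≤ T := by linarith
  have hKT : K + 1 ≤ T ^ 2 / 12 := by
    rw [show T ^ 2 / 12 = 12 * (K + 1) ^ 2 by rw [hT]; ring]
    nlinarith only [hK0]
  set p := (N : ℝ) ^ ((1 : ℝ) / 6) with hp
  set τ := tauN N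
  have hp1 : 1 ≤ p := by linarith
  have hp0 : 0 < p := by linarith
  have hTp : T ≤ p ^ 2 := by
    have h := le_self_pow₀ hp1 two_ne_zero
    linarith
  have hp6 : (p ^ 3) ^ 2 = N := by
    rw [hp, ← pow_mul, ← Real.rpow_natCast, ← Real.rpow_mul (by linarith)]
    norm_num
  obtain ⟨r, hr⟩ : ∃ r, r = τ * p := ⟨_, rfl⟩
  have hr0 : 0 < r := by rw [hr]; positivity
  have hr2 : r ^ 2 = 1 / 2 := by rw [hr, mul_pow, hτp]
  have hr1 : r ≤ 1 := by nlinarith only [hr2]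
  have hrh : 1 / 2 ≤ r := by nlinarith only [hr2, hr0]
  have hτr : τ ≤ r := by rw [hr]; exact le_mul_of_one_le_right hτ.le hp1
  have hmτ : m * τ ≤ 1 := by
    calc m * τ ≤ p * τ := by gcongr; linarith
      _ = r := by rw [hr, mul_comm]
      _ ≤ 1 := hr1
  set u := √(2 * n + 1) with hu
  have hu2 : u ^ 2 = 2 * n + 1 := Real.sq_sqrt (by positivity)
  have hu0 : 0 ≤ u := Real.sqrt_nonneg _
  have hu1 : 1 ≤ u := by nlinarith only [hu2, hu0, hn']
  have hup : u ≤ 2 * p ^ 3 := by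
    rw [← pow_le_pow_iff_left₀ hu0 (by positivity) two_ne_zero, mul_pow, hp6, hu2]
    linarith
  obtain ⟨b, hb0, hbn⟩ : ∃ b : ℝ, 0 < b ∧ 2 * b ^ 2 = n := by
    refine ⟨√(n / 2), by positivity, ?_⟩
    rw [Real.sq_sqrt (by positivity)]
    ring
  have hbp : p ^ 3 ≤ 2 * b := by
    rw [← pow_le_pow_iff_left₀ (by positivity) (by positivity) two_ne_zero, mul_pow, hp6]
    linarith
  have hub : 2 * b ≤ u := by
    rw [← pow_le_pow_iff_left₀ (by positivity) (by positivity) two_ne_zero, mul_pow, hu2]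
    linarith
  set x := u + s * τ with hx
  have hsτ : -(m * τ) ≤ s * τ := by
    rw [← neg_mul]
    gcongr
  have hκp : κ ≤ κ * p := le_mul_of_one_le_right (by linarith) hp1
  have hba : b ≤ x / 2 + κ * p := by linarith
  have huτ : u * τ ≤ 2 * p ^ 2 := by
    calc u * τ ≤ 2 * p ^ 3 * τ := by gcongr
      _ = 2 * p ^ 2 * r := by rw [hr]; ring
      _ ≤ 2 * p ^ 2 * 1 := by gcongr
      _ = 2 * p ^ 2 := mul_one _
  have hx2 : u ^ 2 - 4 * m * p ^ 2 ≤ x ^ 2 :=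
    sq_add_mul_ge hm hs hτ.le (hmτ.trans hu1) huτ
  have hsaddle : n + 2 * (x / 2 + κ * p) * (x / 2 + κ * p - x) ≤ K * p ^ 2 := by
    rw [hK]
    linarith
  refine (abs_rescaled_osc_le hn hN hNn hnN hb0 hbn hba (by linarith) hTp hKT hsaddle).trans ?_
  have hexp := exponent_le (b := b) (δ := κ * p) (x := x) (m := m * τ) hb0 (by positivity)
    (by linarith) (by positivity) (by linarith [mul_nonneg hm hτ.le])
  have hcubic : 2 * (κ * p) ^ 3 / (3 * b) ≤ 2 * κ ^ 3 := by
    rw [div_le_iff₀ (by positivity)]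
    calc 2 * (κ * p) ^ 3 = 2 * κ ^ 3 * p ^ 3 := by ring
      _ ≤ 2 * κ ^ 3 * (3 * b) := by gcongr; linarith
  have hlin : 2 * (κ * p) * (m * τ) - 2 * (κ * p) * (x / 2 - b) ≤ 3 * κ * m - 2 * s := by
    have h1 : 2 * (κ * p) * (s * τ / 2) ≤ 2 * (κ * p) * (x / 2 - b) := by
      gcongr
      linarith
    have h2 : 2 * (κ * p) * (s * τ / 2) = κ * s * r := by rw [hr]; ring
    have h3 : 2 * (κ * p) * (m * τ) = 2 * (κ * m) * r := by rw [hr]; ring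
    have h4 := linear_exponent_le hm hs hκ0 hrh hr1
    linarith
  have hapre : (x / 2 + κ * p) / p ^ 3 ≤ (1 + m + κ) * Real.exp (s + m) :=
    base_point_div_le hm hs hτ.le (hτr.trans hr1) (by linarith) hp1 hup
  exact mul_le_mul (mul_le_mul_of_nonneg_left hapre (by positivity))
    (Real.exp_le_exp.2 (by linarith)) (Real.exp_pos _).le (by positivity)

end OscillatorEstimate

/-- Uniform exponential bound on the rescaled oscillator wave functions near the
upper turning point: for `j ∈ {N-1, N}`, `u_j = √(2j+1)`,
`|(2N)^{1/4} τ_N φ_j(u_j + s τ_N)| ≤ C e^{-s}` for all `s ≥ s_L`. -/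
theorem rescaled_osc_exponential_bound (sL : ℝ) :
    ∃ C > 0, ∃ N₀ : ℕ, ∀ N : ℕ, N₀ ≤ N → ∀ j ∈ ({N - 1, N} : Set ℕ), ∀ s : ℝ, sL ≤ s →
      |(2 * N : ℝ) ^ ((1 : ℝ) / 4) * tauN N *
          osc j (Real.sqrt (2 * j + 1) + s * tauN N)| ≤ C * Real.exp (-s) := by
  obtain ⟨m, hm⟩ : ∃ m, m = |sL| := ⟨_, rfl⟩
  obtain ⟨κ, hκ⟩ : ∃ κ, κ = 4 + m := ⟨_, rfl⟩
  obtain ⟨K, hK⟩ : ∃ K, K = 2 * κ ^ 2 + 2 * m := ⟨_, rfl⟩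
  obtain ⟨T, hT⟩ : ∃ T, T = 12 * (K + 1) := ⟨_, rfl⟩
  have hm0 : 0 ≤ m := hm ▸ abs_nonneg sL
  have hκ0 : 0 ≤ κ := by linarith
  have hK0 : 0 ≤ K := by rw [hK]; positivity
  refine ⟨6 * Real.exp (T ^ 3 / 6) * ((1 + m + κ) * Real.exp m) *
    Real.exp (2 * κ ^ 3 + 3 * κ * m), by positivity, ⌈(T + m + 2) ^ 6⌉₊ + 2, ?_⟩
  intro N hN j hj s hs
  have hTN : T + m + 2 ≤ (N : ℝ) ^ ((1 : ℝ) / 6) := by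
    have h1 : (T + m + 2) ^ 6 ≤ (N : ℝ) :=
      (Nat.le_ceil _).trans (by exact_mod_cast (Nat.le_add_right _ 2).trans hN)
    have h2 : ((N : ℝ) ^ ((1 : ℝ) / 6)) ^ 6 = N := by
      rw [← Real.rpow_natCast, ← Real.rpow_mul (Nat.cast_nonneg N)]
      norm_num
    rwa [← h2, pow_le_pow_iff_left₀ (by linarith) (by positivity) (by norm_num)] at h1
  have hj' : 0 < j ∧ N ≤ 2 * j ∧ j ≤ N := by
    rcases hj with rfl | rfl <;> omega
  refine (abs_rescaled_osc_turning_point_le hj'.1 (by omega) hj'.2.1 hj'.2.2 hm0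
    (by rw [hm]; linarith [neg_abs_le sL]) hκ hK hT hTN).trans_eq ?_
  have h : Real.exp m * Real.exp (2 * κ ^ 3 + 3 * κ * m) * Real.exp (-s) =
      Real.exp (s + m) * Real.exp (2 * κ ^ 3 + 3 * κ * m - 2 * s) := by
    rw [← Real.exp_add, ← Real.exp_add, ← Real.exp_add]
    congr 1
    ring
  linear_combination (-6 * Real.exp (T ^ 3 / 6) * (1 + m + κ)) * h
end

section
/- For every real s_L there exist constants C > 0 and N₀ ∈ ℕ (depending only on s_L) such that for all N ≥ N₀, for j ∈ {N−1, N} with u_j = √(2j+1), and for all s ≥ s_L: |(2N)^{1/4} τ_N φ_j(u_j + s τ_N) − Ai(s)| ≤ C N^{−2/3} e^{−s/2}, where τ_N = 2^{−1/2} N^{−1/6}. -/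
open Real Filter MeasureTheory

/-- Polynomial growth against a Gaussian. -/
lemma pow_mul_exp_neg_sq_le {a b : ℝ} (ha : 0 ≤ a) (hb : 0 < b) (k : ℕ) (y : ℝ) :
    (a + |y|) ^ k * Real.exp (-b * y ^ 2) ≤
      k.factorial * Real.exp (a + 1 / (2 * b)) * Real.exp (-(b / 2) * y ^ 2) := by
  have h1 : (a + |y|) ^ k ≤ k.factorial * Real.exp (a + |y|) := by
    have := Real.pow_div_factorial_le_exp (a + |y|) (by positivity) k
    rwa [div_le_iff₀' (by positivity)] at this
  have h2 : |y| - b * y ^ 2 ≤ 1 / (2 * b) - b / 2 * y ^ 2 := by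
    have h3 : 1 / (2 * b) - b / 2 * y ^ 2 - (|y| - b * y ^ 2) = (b * |y| - 1) ^ 2 / (2 * b) := by
      rw [← sq_abs y]
      field_simp
      ring
    have h4 : 0 ≤ (b * |y| - 1) ^ 2 / (2 * b) := by positivity
    linarith
  calc (a + |y|) ^ k * Real.exp (-b * y ^ 2)
      ≤ k.factorial * Real.exp (a + |y|) * Real.exp (-b * y ^ 2) := by gcongr
    _ = k.factorial * Real.exp (a + |y| - b * y ^ 2) := by
        rw [mul_assoc, ← Real.exp_add]; ring_nf
    _ ≤ k.factorial * Real.exp (a + 1 / (2 * b) - b / 2 * y ^ 2) := by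
        gcongr 2; linarith
    _ = _ := by rw [mul_assoc, ← Real.exp_add]; ring_nf

lemma integrable_pow_mul_exp_neg_sq {a b : ℝ} (ha : 0 ≤ a) (hb : 0 < b) (k : ℕ) :
    Integrable (fun y : ℝ => (a + |y|) ^ k * Real.exp (-b * y ^ 2)) := by
  refine Integrable.mono' (((integrable_exp_neg_mul_sq (half_pos hb)).const_mul
    (k.factorial * Real.exp (a + 1 / (2 * b))))) (by fun_prop) (.of_forall fun y => ?_)
  rw [Real.norm_of_nonneg (by positivity)]
  exact pow_mul_exp_neg_sq_le ha hb k y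

/-- Integrand of the integral representation of the derivatives of a Gaussian
along the vertical line of abscissa `c`. -/
noncomputable def gaussLine (c : ℝ) (n : ℕ) (x y : ℝ) : ℂ :=
  (c + y * Complex.I) ^ n *
    Complex.exp ((c + y * Complex.I) ^ 2 - 2 * (c + y * Complex.I) * x)

lemma continuous_gaussLine (c : ℝ) (n : ℕ) (x : ℝ) : Continuous (gaussLine c n x) := by
  unfold gaussLine; fun_prop

lemma norm_add_mul_I_le (c y : ℝ) : ‖(c + y * Complex.I : ℂ)‖ ≤ |c| + |y| := by
  refine (norm_add_le _ _).trans (by simp)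

lemma norm_gaussLine_le (c : ℝ) (n : ℕ) {x R : ℝ} (hx : |x| ≤ R) (y : ℝ) :
    ‖gaussLine c n x y‖ ≤
      Real.exp (c ^ 2 + 2 * |c| * R) * ((|c| + |y|) ^ n * Real.exp (-1 * y ^ 2)) := by
  rw [gaussLine, norm_mul, norm_pow, Complex.norm_exp]
  have h1 : ((c + y * Complex.I : ℂ) ^ 2 - 2 * (c + y * Complex.I) * x).re
      = c ^ 2 - y ^ 2 - 2 * c * x := by
    simp [pow_two]
  have h2 : -(c * x) ≤ |c| * R := by
    calc -(c * x) ≤ |c * x| := neg_le_abs _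
      _ = |c| * |x| := abs_mul _ _
      _ ≤ |c| * R := by gcongr
  rw [h1]
  calc _ ≤ (|c| + |y|) ^ n * Real.exp (c ^ 2 + 2 * |c| * R + -1 * y ^ 2) := by
        gcongr
        · exact norm_add_mul_I_le c y
        · linarith
    _ = _ := by rw [Real.exp_add]; ring

lemma integrable_gaussLine (c : ℝ) (n : ℕ) (x : ℝ) : Integrable (gaussLine c n x) :=
  Integrable.mono' ((integrable_pow_mul_exp_neg_sq (abs_nonneg c) one_pos n).const_mul _)
    (continuous_gaussLine c n x).aestronglyMeasurable
    (.of_forall fun y => norm_gaussLine_le c n le_rfl y)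

lemma hasDerivAt_integral_gaussLine (c : ℝ) (n : ℕ) (x : ℝ) :
    HasDerivAt (fun x => ∫ y, gaussLine c n x y) (-2 * ∫ y, gaussLine c (n + 1) x y) x := by
  rw [← integral_const_mul]
  refine (hasDerivAt_integral_of_dominated_loc_of_deriv_le (s := Metric.ball x 1)
    (F := fun x y => gaussLine c n x y) (F' := fun x y => -2 * gaussLine c (n + 1) x y)
    (bound := fun y => 2 * (Real.exp (c ^ 2 + 2 * |c| * (|x| + 1)) *
      ((|c| + |y|) ^ (n + 1) * Real.exp (-1 * y ^ 2))))
    (Metric.ball_mem_nhds x one_pos)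
    (.of_forall fun x => (continuous_gaussLine c n x).aestronglyMeasurable)
    (integrable_gaussLine c n x)
    ((continuous_gaussLine c (n + 1) x).const_smul (-2 : ℂ)).aestronglyMeasurable
    (.of_forall fun y t ht => ?_)
    (((integrable_pow_mul_exp_neg_sq (abs_nonneg c) one_pos (n + 1)).const_mul _).const_mul _)
    (.of_forall fun y t _ => ?_)).2
  · rw [norm_mul]
    have h1 : |t| ≤ |x| + 1 := by
      have h2 : |t - x| < 1 := by simpa [Real.dist_eq] using ht
      have h3 := abs_add_le (t - x) x
      rw [sub_add_cancel] at h3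
      linarith
    have h2 := norm_gaussLine_le c (n + 1) h1 y
    simpa using h2
  · unfold gaussLine
    have h1 : HasDerivAt (fun t : ℝ => (c + y * Complex.I : ℂ) ^ 2 -
        2 * (c + y * Complex.I) * t) (-(2 * (c + y * Complex.I))) t := by
      simpa using ((Complex.ofRealCLM.hasDerivAt (x := t)).const_mul
        (2 * (c + y * Complex.I : ℂ))).const_sub ((c + y * Complex.I : ℂ) ^ 2)
    exact (h1.cexp.const_mul ((c + y * Complex.I : ℂ) ^ n)).congr_deriv (by ring)

lemma integral_gaussLine_zero (c x : ℝ) :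
    ∫ y, gaussLine c 0 x y = (Real.sqrt Real.pi : ℂ) * Complex.exp (-(x : ℂ) ^ 2) := by
  have h := integral_cexp_quadratic (b := -1) (by simp) (2 * (c - x) * Complex.I)
    (c ^ 2 - 2 * c * x)
  have h2 : ∀ y : ℝ, gaussLine c 0 x y =
      Complex.exp (-1 * (y : ℂ) ^ 2 + 2 * (c - x) * Complex.I * y + (c ^ 2 - 2 * c * x)) := by
    intro y
    rw [gaussLine, pow_zero, one_mul]
    congr 1
    linear_combination (y : ℂ) ^ 2 * Complex.I_sq
  simp_rw [h2, h]
  congr 1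
  · rw [neg_neg, div_one, Real.sqrt_eq_rpow, Complex.ofReal_cpow Real.pi_pos.le]
    norm_num
  · congr 1
    linear_combination (c - x : ℂ) ^ 2 * Complex.I_sq

lemma iteratedDeriv_gauss_eq_integral (c : ℝ) (n : ℕ) :
    ∀ x : ℝ, ((iteratedDeriv n (fun t : ℝ => Real.exp (-t ^ 2)) x : ℝ) : ℂ) =
      (-2) ^ n / (Real.sqrt Real.pi : ℂ) * ∫ y, gaussLine c n x y := by
  have hpi : (Real.sqrt Real.pi : ℂ) ≠ 0 := by
    exact_mod_cast (Real.sqrt_pos.2 Real.pi_pos).ne'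
  have hre : ∀ (n : ℕ) (x : ℝ), HasDerivAt (iteratedDeriv n (fun t : ℝ => Real.exp (-t ^ 2)))
      (iteratedDeriv (n + 1) (fun t : ℝ => Real.exp (-t ^ 2)) x) x := by
    intro n x
    rw [iteratedDeriv_succ]
    have h : ContDiff ℝ (n + 1 : ℕ) (fun t : ℝ => Real.exp (-t ^ 2)) := by fun_prop
    exact (h.differentiable_iteratedDeriv n (by exact_mod_cast Nat.lt_succ_self n) x).hasDerivAt
  induction n with
  | zero =>
    intro x
    rw [integral_gaussLine_zero]
    simp [field]
  | succ n ih =>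
    intro x
    have h1 := (hre n x).ofReal_comp
    have h2 := (hasDerivAt_integral_gaussLine c n x).const_mul
      ((-2) ^ n / (Real.sqrt Real.pi : ℂ))
    simp_rw [ih] at h1
    rw [h1.unique h2]
    ring

/-- Integrand of the contour integral for the Airy function on the vertical line of
abscissa `σ`. -/
noncomputable def airyLine (σ s v : ℝ) : ℂ :=
  Complex.exp ((σ + v * Complex.I) ^ 3 / 3 - s * (σ + v * Complex.I))

lemma norm_airyLine (σ s v : ℝ) :
    ‖airyLine σ s v‖ = Real.exp (σ ^ 3 / 3 - s * σ - σ * v ^ 2) := by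
  have h : ((σ + v * Complex.I : ℂ) ^ 3 / 3 - s * (σ + v * Complex.I)) =
      ((σ ^ 3 / 3 - s * σ - σ * v ^ 2 : ℝ) : ℂ) +
        ((σ ^ 2 * v - v ^ 3 / 3 - s * v : ℝ) : ℂ) * Complex.I := by
    push_cast
    linear_combination (σ * v ^ 2 + v ^ 3 / 3 * Complex.I : ℂ) * Complex.I_sq
  rw [airyLine, h, Complex.norm_exp, Complex.add_re, Complex.ofReal_re, Complex.re_ofReal_mul,
    Complex.I_re, mul_zero, add_zero]

lemma continuous_airyLine (σ s : ℝ) : Continuous (airyLine σ s) := by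
  unfold airyLine; fun_prop

lemma integrable_airyLine {σ : ℝ} (hσ : 0 < σ) (s : ℝ) : Integrable (airyLine σ s) := by
  refine Integrable.mono' ((integrable_exp_neg_mul_sq hσ).const_mul
    (Real.exp (σ ^ 3 / 3 - s * σ))) (continuous_airyLine σ s).aestronglyMeasurable
    (.of_forall fun v => ?_)
  rw [norm_airyLine, ← Real.exp_add]
  exact Real.exp_le_exp.2 (by linarith)

lemma tendsto_integral_airy_side {σ : ℝ} (hσ : 0 < σ) (s : ℝ) {ε : ℝ} (hε : ε ^ 2 = 1) :
    Tendsto (fun R : ℝ => ∫ x in (0 : ℝ)..σ, airyLine x s (ε * R)) atTop (nhds 0) := by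
  have h0 : ∫ x in (0 : ℝ)..σ, (0 : ℂ) = 0 := by simp
  rw [← h0]
  refine intervalIntegral.tendsto_integral_filter_of_dominated_convergence
    (fun _ => Real.exp (σ ^ 3 / 3 + |s| * σ)) (.of_forall fun R => ?_)
    (.of_forall fun R => .of_forall fun x hx => ?_) (by simp) (.of_forall fun x hx => ?_)
  · have : Continuous fun x => airyLine x s (ε * R) := by unfold airyLine; fun_prop
    exact this.aestronglyMeasurable
  · rw [Set.uIoc_of_le hσ.le] at hx
    rw [norm_airyLine]
    have h1 : x ^ 3 ≤ σ ^ 3 := pow_le_pow_left₀ hx.1.le hx.2 3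
    have h2 : -(s * x) ≤ |s| * σ :=
      calc -(s * x) ≤ |s * x| := neg_le_abs _
        _ = |s| * x := by rw [abs_mul, abs_of_pos hx.1]
        _ ≤ |s| * σ := by gcongr; exact hx.2
    have h3 : 0 ≤ x * (ε * R) ^ 2 := mul_nonneg hx.1.le (sq_nonneg _)
    exact Real.exp_le_exp.2 (by linarith)
  · rw [Set.uIoc_of_le hσ.le] at hx
    rw [tendsto_zero_iff_norm_tendsto_zero]
    simp_rw [norm_airyLine]
    refine Real.tendsto_exp_atBot.comp ?_
    refine tendsto_atBot_add_const_left _ (x ^ 3 / 3 - s * x) ?_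
    simp_rw [mul_pow, hε, one_mul]
    exact tendsto_neg_atTop_atBot.comp
      ((tendsto_pow_atTop two_ne_zero).const_mul_atTop hx.1)

lemma tendsto_integral_airyLine_zero {σ : ℝ} (hσ : 0 < σ) (s : ℝ) :
    Tendsto (fun R : ℝ => ∫ v in (-R)..R, airyLine 0 s v) atTop
      (nhds (∫ v, airyLine σ s v)) := by
  have h1 := tendsto_integral_airy_side hσ s (ε := 1) (by norm_num)
  have h2 := tendsto_integral_airy_side hσ s (ε := -1) (by norm_num)
  have h3 := intervalIntegral_tendsto_integral (integrable_airyLine hσ s)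
    tendsto_neg_atTop_atBot tendsto_id
  have h4 := (h3.add ((h1.sub h2).const_mul Complex.I))
  rw [sub_zero, mul_zero, add_zero] at h4
  refine h4.congr fun R => ?_
  have h5 := Complex.integral_boundary_rect_eq_zero_of_differentiableOn
    (fun z => Complex.exp (z ^ 3 / 3 - s * z)) (((-R : ℝ) : ℂ) * Complex.I) (σ + R * Complex.I)
    (by fun_prop)
  simp only [Complex.mul_re, Complex.add_re, Complex.ofReal_re, Complex.ofReal_im, Complex.I_re,
    Complex.I_im, Complex.mul_im, Complex.add_im, mul_zero, mul_one, sub_zero, add_zero,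
    zero_add, smul_eq_mul] at h5
  simp only [airyLine, id, one_mul, neg_one_mul] at h5 ⊢
  linear_combination (-Complex.I) * h5 +
    ((∫ v in (-R)..R, Complex.exp ((σ + v * Complex.I : ℂ) ^ 3 / 3 - s * (σ + v * Complex.I))) -
      ∫ v in (-R)..R, Complex.exp (((0 : ℝ) + v * Complex.I : ℂ) ^ 3 / 3 -
        s * ((0 : ℝ) + v * Complex.I))) * Complex.I_sq

lemma re_integral_airyLine_zero (s R : ℝ) :
    (∫ v in (-R)..R, airyLine 0 s v).re =
      2 * ∫ t in (0 : ℝ)..R, Real.cos (t ^ 3 / 3 + s * t) := by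
  have hc : Continuous fun t : ℝ => Real.cos (t ^ 3 / 3 + s * t) := by fun_prop
  have h1 : (∫ v in (-R)..R, airyLine 0 s v).re = ∫ v in (-R)..R, (airyLine 0 s v).re :=
    (Complex.reCLM.intervalIntegral_comp_comm
      ((continuous_airyLine 0 s).intervalIntegrable _ _)).symm
  have h2 : ∀ v : ℝ, (airyLine 0 s v).re = Real.cos (v ^ 3 / 3 + s * v) := by
    intro v
    have h : (((0 : ℝ) + v * Complex.I : ℂ) ^ 3 / 3 - s * ((0 : ℝ) + v * Complex.I)) =
        ((-(v ^ 3 / 3 + s * v) : ℝ) : ℂ) * Complex.I := by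
      push_cast
      linear_combination (v ^ 3 / 3 * Complex.I : ℂ) * Complex.I_sq
    rw [airyLine, h, Complex.exp_ofReal_mul_I_re, Real.cos_neg]
  have h3 : ∫ t in (-R)..0, Real.cos (t ^ 3 / 3 + s * t) =
      ∫ t in (0 : ℝ)..R, Real.cos (t ^ 3 / 3 + s * t) := by
    have h := intervalIntegral.integral_comp_neg (a := 0) (b := R)
      (fun t : ℝ => Real.cos (t ^ 3 / 3 + s * t))
    rw [neg_zero] at h
    rw [← h]
    refine intervalIntegral.integral_congr fun t _ => ?_
    rw [← Real.cos_neg]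
    congr 1
    ring
  rw [h1]
  simp_rw [h2]
  rw [← intervalIntegral.integral_add_adjacent_intervals (hc.intervalIntegrable (-R) 0)
    (hc.intervalIntegrable 0 R), h3]
  ring

/-- The Airy function as an absolutely convergent contour integral. -/
lemma Ai_eq_integral {σ : ℝ} (hσ : 0 < σ) (s : ℝ) :
    Ai s = (2 * Real.pi)⁻¹ * (∫ v, airyLine σ s v).re := by
  have h := (Complex.continuous_re.tendsto _).comp (tendsto_integral_airyLine_zero hσ s)
  have h2 : Tendsto (fun R : ℝ => ∫ t in (0 : ℝ)..R, Real.cos (t ^ 3 / 3 + s * t)) atTop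
      (nhds (2⁻¹ * (∫ v, airyLine σ s v).re)) := by
    refine (h.const_mul 2⁻¹).congr fun R => ?_
    simp [re_integral_airyLine_zero]
  rw [Ai, h2.limUnder_eq]
  rw [mul_inv]
  ring

/-- Taylor remainder of the logarithm, uniformly on the closed right half plane. -/
lemma norm_log_one_add_sub_logTaylor_le {p : ℂ} (hp : 0 ≤ p.re) (n : ℕ) :
    ‖Complex.log (1 + p) - Complex.logTaylor (n + 1) p‖ ≤ ‖p‖ ^ (n + 1) := by
  have hre : ∀ t : ℝ, 0 ≤ t → 1 ≤ (1 + t * p).re := fun t ht => by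
    simpa using mul_nonneg ht hp
  have hd : ∀ t : ℝ, 0 ≤ t → HasDerivAt (fun t : ℝ => Complex.log (1 + t * p) -
      Complex.logTaylor (n + 1) (t * p)) ((-(t * p)) ^ n * (1 + t * p)⁻¹ * p) t := by
    intro t ht
    have h1 := Complex.hasDerivAt_log_sub_logTaylor n (z := t * p)
      (Complex.mem_slitPlane_iff.2 (.inl (by linarith [hre t ht])))
    have h2 : HasDerivAt (fun t : ℝ => (t : ℂ) * p) p t := by
      simpa using (Complex.ofRealCLM.hasDerivAt (x := t)).mul_const p
    exact h1.comp t h2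
  have h := norm_image_sub_le_of_norm_deriv_le_segment_01' (C := ‖p‖ ^ (n + 1))
    (fun t ht => (hd t ht.1).hasDerivWithinAt) (fun t ht => ?_)
  · simpa [Complex.logTaylor_at_zero] using h
  · have h1 : 1 ≤ ‖1 + t * p‖ := (hre t ht.1).trans (Complex.re_le_norm _)
    rw [norm_mul, norm_mul, norm_pow, norm_neg, norm_mul, norm_inv, pow_succ,
      Complex.norm_real, Real.norm_of_nonneg ht.1]
    have h2 : t * ‖p‖ ≤ ‖p‖ := mul_le_of_le_one_left (norm_nonneg _) ht.2.le
    have h3 : ‖1 + t * p‖⁻¹ ≤ 1 := inv_le_one_of_one_le₀ h1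
    calc (t * ‖p‖) ^ n * ‖1 + t * p‖⁻¹ * ‖p‖ ≤ ‖p‖ ^ n * 1 * ‖p‖ := by
          have := ht.1
          gcongr
      _ = _ := by ring

lemma exp_mul_le_max {r : ℝ} (h0 : 0 ≤ r) (h1 : r ≤ 1) (x : ℝ) :
    Real.exp (r * x) ≤ max 1 (Real.exp x) := by
  rcases le_total x 0 with h | h
  · exact (Real.exp_le_one_iff.2 (mul_nonpos_of_nonneg_of_nonpos h0 h)).trans (le_max_left _ _)
  · exact (Real.exp_le_exp.2 (mul_le_of_le_one_left h h1)).trans (le_max_right _ _)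

lemma norm_exp_sub_one_le_max (z : ℂ) :
    ‖Complex.exp z - 1‖ ≤ ‖z‖ * max 1 (Real.exp z.re) := by
  have h := norm_image_sub_le_of_norm_deriv_le_segment_01'
    (f := fun r : ℝ => Complex.exp (r * z)) (f' := fun r : ℝ => Complex.exp (r * z) * z)
    (C := ‖z‖ * max 1 (Real.exp z.re)) (fun r _ => ?_) (fun r hr => ?_)
  · simpa using h
  · have hlin : HasDerivAt (fun t : ℝ => (t : ℂ) * z) z r := by
      simpa using (Complex.ofRealCLM.hasDerivAt (x := r)).mul_const z
    exact hlin.cexp.hasDerivWithinAt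
  · rw [norm_mul, mul_comm, Complex.norm_exp, Complex.re_ofReal_mul]
    gcongr
    exact exp_mul_le_max hr.1 hr.2.le z.re

lemma norm_exp_sub_one_sub_id_le_max (z : ℂ) :
    ‖Complex.exp z - 1 - z‖ ≤ ‖z‖ ^ 2 * max 1 (Real.exp z.re) := by
  have h := norm_image_sub_le_of_norm_deriv_le_segment_01'
    (f := fun r : ℝ => Complex.exp (r * z) - 1 - r * z)
    (f' := fun r : ℝ => Complex.exp (r * z) * z - z)
    (C := ‖z‖ ^ 2 * max 1 (Real.exp z.re)) (fun r _ => ?_) (fun r hr => ?_)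
  · simpa using h
  · have hlin : HasDerivAt (fun t : ℝ => (t : ℂ) * z) z r := by
      simpa using (Complex.ofRealCLM.hasDerivAt (x := r)).mul_const z
    exact ((hlin.cexp.sub_const 1).sub hlin).hasDerivWithinAt
  · have h1 := norm_exp_sub_one_le_max (r * z)
    rw [norm_mul, Complex.norm_real, Real.norm_of_nonneg hr.1, Complex.re_ofReal_mul] at h1
    have h2 := max_le (le_max_left 1 _) (exp_mul_le_max hr.1 hr.2.le z.re)
    have h3 : r * ‖z‖ ≤ ‖z‖ := mul_le_of_le_one_left (norm_nonneg _) hr.2.le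
    rw [show Complex.exp (r * z) * z - z = (Complex.exp (r * z) - 1) * z by ring, norm_mul]
    calc _ ≤ ‖z‖ * max 1 (Real.exp z.re) * ‖z‖ := by
          gcongr
          exact h1.trans (by gcongr)
      _ = _ := by ring

/-- Rescaled integrand of the contour integral for the oscillator wave functions. -/
noncomputable def oscLine (n : ℕ) (δ σ s v : ℝ) : ℂ :=
  (1 + δ * (σ + v * Complex.I)) ^ n *
    Complex.exp (s ^ 2 * δ / 4 + (n + 1 / 2) * (-(δ * (σ + v * Complex.I)) +
      (δ * (σ + v * Complex.I)) ^ 2 / 2) - s * (σ + v * Complex.I))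

lemma continuous_oscLine (n : ℕ) (δ σ s : ℝ) : Continuous (oscLine n δ σ s) := by
  unfold oscLine; fun_prop

lemma norm_oscLine_le {n : ℕ} {δ σ : ℝ} (hδ : 0 < δ) (hδ2 : δ ≤ 1 / 2)
    (hm : δ ^ 3 * (n + 1 / 2) = 1) (hσ : 2 ≤ σ) (s v : ℝ) :
    ‖oscLine n δ σ s v‖ ≤ Real.exp (s ^ 2 * δ / 4 - s * σ +
      (n + 1 / 2) * (Real.log (1 + δ * σ) - δ * σ + (δ * σ) ^ 2 / 2) - v ^ 2 / 2) := by
  set a := δ * σ with ha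
  set b := δ * v with hb
  have ha0 : 0 < a := by positivity
  have ha2 : 2 * δ ≤ a := by rw [ha]; nlinarith
  have hp : (1 + δ * (σ + v * Complex.I) : ℂ) = (1 + a : ℝ) + (b : ℝ) * Complex.I := by
    rw [ha, hb]; push_cast; ring
  have hn2 : ‖(1 + δ * (σ + v * Complex.I) : ℂ)‖ ^ 2 = (1 + a) ^ 2 + b ^ 2 := by
    rw [← Complex.normSq_eq_norm_sq, hp, Complex.normSq_add_mul_I]
  set r := ‖(1 + δ * (σ + v * Complex.I) : ℂ)‖ with hr
  have hr0 : 0 < r := by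
    refine (norm_nonneg _).lt_of_ne fun h => ?_
    rw [hr, ← h] at hn2
    nlinarith
  have hlog : Real.log r ≤ Real.log (1 + a) + b ^ 2 / (2 * (1 + a) ^ 2) := by
    have h1 : 2 * Real.log r = Real.log ((1 + a) ^ 2 * (1 + b ^ 2 / (1 + a) ^ 2)) := by
      rw [show (1 + a) ^ 2 * (1 + b ^ 2 / (1 + a) ^ 2) = r ^ 2 by rw [hn2]; field_simp,
        Real.log_pow]
      norm_num
    rw [Real.log_mul (by positivity) (by positivity), Real.log_pow] at h1
    have h2 := Real.log_le_sub_one_of_pos (x := 1 + b ^ 2 / (1 + a) ^ 2) (by positivity)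
    have h3 : b ^ 2 / (2 * (1 + a) ^ 2) = b ^ 2 / (1 + a) ^ 2 / 2 := by field_simp
    push_cast at h1
    linarith
  have hre : (s ^ 2 * δ / 4 + (n + 1 / 2) * (-(δ * (σ + v * Complex.I)) +
      (δ * (σ + v * Complex.I)) ^ 2 / 2) - s * (σ + v * Complex.I) : ℂ).re =
      s ^ 2 * δ / 4 + (n + 1 / 2) * (-a + (a ^ 2 - b ^ 2) / 2) - s * σ := by
    have : (s ^ 2 * δ / 4 + (n + 1 / 2) * (-(δ * (σ + v * Complex.I)) +
      (δ * (σ + v * Complex.I)) ^ 2 / 2) - s * (σ + v * Complex.I) : ℂ) =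
      ((s ^ 2 * δ / 4 + (n + 1 / 2) * (-a + (a ^ 2 - b ^ 2) / 2) - s * σ : ℝ) : ℂ) +
      (((n + 1 / 2) * (-b + a * b) - s * v : ℝ) : ℂ) * Complex.I := by
      rw [ha, hb]
      push_cast
      linear_combination ((n + 1 / 2) * (δ * v) ^ 2 / 2 : ℂ) * Complex.I_sq
    rw [this, Complex.add_re, Complex.ofReal_re, Complex.re_ofReal_mul,
      Complex.I_re, mul_zero, add_zero]
  rw [oscLine, norm_mul, norm_pow, ← hr, Complex.norm_exp, hre,
    show r ^ n = Real.exp (n * Real.log r) by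
      rw [Real.exp_nat_mul, Real.exp_log hr0], ← Real.exp_add]
  refine Real.exp_le_exp.2 ?_
  have hla : 0 ≤ Real.log (1 + a) := Real.log_nonneg (by linarith)
  have h1 : n * Real.log r ≤ (n + 1 / 2) * (Real.log (1 + a) + b ^ 2 / (2 * (1 + a) ^ 2)) :=
    calc n * Real.log r ≤ n * (Real.log (1 + a) + b ^ 2 / (2 * (1 + a) ^ 2)) := by gcongr
      _ ≤ _ := by gcongr; linarith
  have h2 : δ ≤ 1 - 1 / (1 + a) ^ 2 := by
    rw [le_sub_iff_add_le, ← le_sub_iff_add_le', div_le_iff₀ (by positivity)]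
    have h3 : (1 + 2 * δ) ^ 2 ≤ (1 + a) ^ 2 := by gcongr
    have h4 : 1 ≤ (1 - δ) * (1 + 2 * δ) ^ 2 := by
      nlinarith [mul_pos hδ hδ, mul_nonneg (mul_pos hδ hδ).le (sub_nonneg.2 hδ2)]
    exact h4.trans (by gcongr; linarith)
  have h3 : v ^ 2 / 2 ≤ (n + 1 / 2) * (b ^ 2 / 2 - b ^ 2 / (2 * (1 + a) ^ 2)) := by
    have h4 : (n + 1 / 2) * (b ^ 2 / 2 - b ^ 2 / (2 * (1 + a) ^ 2)) =
        (n + 1 / 2) * δ ^ 2 * (v ^ 2 / 2) * (1 - 1 / (1 + a) ^ 2) := by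
      rw [hb]; field_simp
    rw [h4]
    calc v ^ 2 / 2 = (n + 1 / 2) * δ ^ 2 * (v ^ 2 / 2) * δ := by
          linear_combination (-(v ^ 2 / 2)) * hm
      _ ≤ _ := by gcongr
  linarith

lemma integrable_oscLine {n : ℕ} {δ σ : ℝ} (hδ : 0 < δ) (hδ2 : δ ≤ 1 / 2)
    (hm : δ ^ 3 * (n + 1 / 2) = 1) (hσ : 2 ≤ σ) (s : ℝ) : Integrable (oscLine n δ σ s) := by
  refine Integrable.mono' ((integrable_exp_neg_mul_sq (b := 1 / 2) (by norm_num)).const_mul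
    (Real.exp (s ^ 2 * δ / 4 - s * σ +
      (n + 1 / 2) * (Real.log (1 + δ * σ) - δ * σ + (δ * σ) ^ 2 / 2))))
    (continuous_oscLine n δ σ s).aestronglyMeasurable (.of_forall fun v => ?_)
  refine (norm_oscLine_le hδ hδ2 hm hσ s v).trans (le_of_eq ?_)
  rw [← Real.exp_add]
  ring_nf

/-- Relative exponent of `oscLine` with respect to `airyLine`. -/
noncomputable def oscExponent (n : ℕ) (δ s : ℝ) (w : ℂ) : ℂ :=
  n * Complex.log (1 + δ * w) + (n + 1 / 2) * (-(δ * w) + (δ * w) ^ 2 / 2) +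
    s ^ 2 * δ / 4 - w ^ 3 / 3

/-- First order part in `δ` of `oscExponent`. -/
noncomputable def oscExponentLead (δ s : ℝ) (w : ℂ) : ℂ :=
  δ * (-w ^ 4 / 4 - w / 2 + s ^ 2 / 4)

lemma oscLine_eq {δ σ : ℝ} (hδ : 0 < δ) (hσ : 0 < σ) (n : ℕ) (s v : ℝ) :
    oscLine n δ σ s v =
      airyLine σ s v * Complex.exp (oscExponent n δ s (σ + v * Complex.I)) := by
  have h0 : (1 + δ * (σ + v * Complex.I) : ℂ) ≠ 0 := by
    intro h
    have := congrArg Complex.re h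
    simp at this
    nlinarith [mul_pos hδ hσ]
  rw [oscLine, airyLine, oscExponent, ← Complex.exp_add]
  nth_rewrite 1 [← Complex.exp_log h0]
  rw [← Complex.exp_nat_mul, ← Complex.exp_add]
  congr 1
  ring

lemma logTaylor_two (p : ℂ) : Complex.logTaylor 2 p = p := by
  simp [Complex.logTaylor_succ, Complex.logTaylor_zero]

lemma logTaylor_three (p : ℂ) : Complex.logTaylor 3 p = p - p ^ 2 / 2 := by
  rw [Complex.logTaylor_succ, Pi.add_apply, logTaylor_two]
  push_cast
  ring

lemma logTaylor_four (p : ℂ) : Complex.logTaylor 4 p = p - p ^ 2 / 2 + p ^ 3 / 3 := by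
  rw [Complex.logTaylor_succ, Pi.add_apply, logTaylor_three]
  push_cast
  ring

lemma logTaylor_five (p : ℂ) :
    Complex.logTaylor 5 p = p - p ^ 2 / 2 + p ^ 3 / 3 - p ^ 4 / 4 := by
  rw [Complex.logTaylor_succ, Pi.add_apply, logTaylor_four]
  push_cast
  ring

lemma norm_oscExponent_le {n : ℕ} {δ : ℝ} (hδ : 0 < δ) (hm : δ ^ 3 * (n + 1 / 2) = 1)
    (s : ℝ) {w : ℂ} (hw : 0 ≤ w.re) :
    ‖oscExponent n δ s w‖ ≤ δ * (‖w‖ ^ 4 + ‖w‖ + s ^ 2) := by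
  set p : ℂ := δ * w with hp
  have hp0 : 0 ≤ p.re := by simpa [hp] using mul_nonneg hδ.le hw
  have hmc : (δ : ℂ) ^ 3 * (n + 1 / 2) = 1 := by
    have h := congrArg Complex.ofReal hm
    push_cast at h
    exact h
  have hnp : ‖p‖ = δ * ‖w‖ := by rw [hp, norm_mul, Complex.norm_real, Real.norm_of_nonneg hδ.le]
  have h1 := norm_log_one_add_sub_logTaylor_le hp0 3
  have h2 := norm_log_one_add_sub_logTaylor_le hp0 0
  rw [logTaylor_four] at h1
  simp only [zero_add, Complex.logTaylor_succ, Complex.logTaylor_zero] at h2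
  simp at h2
  have hE : oscExponent n δ s w =
      ((n + 1 / 2 : ℝ) : ℂ) * (Complex.log (1 + p) - (p - p ^ 2 / 2 + p ^ 3 / 3)) +
        (((-1 / 2 : ℝ) : ℂ) * Complex.log (1 + p) + ((s ^ 2 * δ / 4 : ℝ) : ℂ)) := by
    rw [oscExponent, ← hp]
    push_cast
    have : w ^ 3 = (n + 1 / 2) * p ^ 3 := by
      rw [hp]; linear_combination (-w ^ 3) * hmc
    rw [this]
    ring
  rw [hE]
  refine (norm_add_le _ _).trans ?_
  have h3 := norm_add_le (((-1 / 2 : ℝ) : ℂ) * Complex.log (1 + p)) ((s ^ 2 * δ / 4 : ℝ) : ℂ)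
  rw [norm_mul, Complex.norm_real, Complex.norm_real,
    Real.norm_of_nonneg (by positivity : 0 ≤ s ^ 2 * δ / 4)] at h3
  rw [norm_mul, Complex.norm_real, Real.norm_of_nonneg (by positivity)]
  have h4 : ((n : ℝ) + 1 / 2) * ‖p‖ ^ 4 = δ * ‖w‖ ^ 4 := by
    rw [hnp]; linear_combination δ * ‖w‖ ^ 4 * hm
  have h5 : ((n : ℝ) + 1 / 2) * ‖Complex.log (1 + p) - (p - p ^ 2 / 2 + p ^ 3 / 3)‖ ≤
      δ * ‖w‖ ^ 4 := by
    rw [← h4]; gcongr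
  rw [hnp] at h2
  have h6 : ‖(-1 / 2 : ℝ)‖ = 1 / 2 := by norm_num
  rw [h6] at h3
  nlinarith [norm_nonneg (Complex.log (1 + p)), mul_nonneg (sq_nonneg s) hδ.le]

lemma norm_oscExponent_sub_lead_le {n : ℕ} {δ : ℝ} (hδ : 0 < δ)
    (hm : δ ^ 3 * (n + 1 / 2) = 1) (s : ℝ) {w : ℂ} (hw : 0 ≤ w.re) :
    ‖oscExponent n δ s w - oscExponentLead δ s w‖ ≤ δ ^ 2 * (‖w‖ ^ 5 + ‖w‖ ^ 2) := by
  set p : ℂ := δ * w with hp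
  have hp0 : 0 ≤ p.re := by simpa [hp] using mul_nonneg hδ.le hw
  have hmc : (δ : ℂ) ^ 3 * (n + 1 / 2) = 1 := by
    have h := congrArg Complex.ofReal hm
    push_cast at h
    exact h
  have hnp : ‖p‖ = δ * ‖w‖ := by rw [hp, norm_mul, Complex.norm_real, Real.norm_of_nonneg hδ.le]
  have h1 := norm_log_one_add_sub_logTaylor_le hp0 4
  have h2 := norm_log_one_add_sub_logTaylor_le hp0 1
  norm_num only at h1 h2
  rw [logTaylor_five] at h1
  rw [logTaylor_two] at h2
  have hE : oscExponent n δ s w - oscExponentLead δ s w =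
      ((n + 1 / 2 : ℝ) : ℂ) * (Complex.log (1 + p) - (p - p ^ 2 / 2 + p ^ 3 / 3 - p ^ 4 / 4)) +
        ((-1 / 2 : ℝ) : ℂ) * (Complex.log (1 + p) - p) := by
    rw [oscExponent, oscExponentLead, ← hp]
    push_cast
    have h3 : w ^ 3 = (n + 1 / 2) * p ^ 3 := by
      rw [hp]; linear_combination (-w ^ 3) * hmc
    have h4 : δ * w ^ 4 = (n + 1 / 2) * p ^ 4 := by
      rw [hp]; linear_combination (-δ * w ^ 4) * hmc
    linear_combination (-1 / 3) * h3 + 1 / 4 * h4 + 1 / 2 * hp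
  rw [hE]
  refine (norm_add_le _ _).trans ?_
  rw [norm_mul, norm_mul, Complex.norm_real, Complex.norm_real, Real.norm_of_nonneg (by positivity)]
  have h4 : ((n : ℝ) + 1 / 2) * ‖p‖ ^ 5 = δ ^ 2 * ‖w‖ ^ 5 := by
    rw [hnp]; linear_combination δ ^ 2 * ‖w‖ ^ 5 * hm
  have h5 : ((n : ℝ) + 1 / 2) *
      ‖Complex.log (1 + p) - (p - p ^ 2 / 2 + p ^ 3 / 3 - p ^ 4 / 4)‖ ≤ δ ^ 2 * ‖w‖ ^ 5 := by
    rw [← h4]; gcongr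
  rw [hnp] at h2
  have h6 : ‖(-1 / 2 : ℝ)‖ = 1 / 2 := by norm_num
  rw [h6]
  nlinarith [norm_nonneg (Complex.log (1 + p) - p)]

lemma norm_airyLine_two_le (s v : ℝ) :
    ‖airyLine 2 s v‖ ≤ Real.exp (|s| - 2 * s + 8 - v ^ 2 / 2) := by
  rw [norm_airyLine]
  exact Real.exp_le_exp.2 (by nlinarith [abs_nonneg s, sq_nonneg v])

lemma norm_oscLine_two_le {n : ℕ} {δ : ℝ} (hδ : 0 < δ) (hδ2 : δ ≤ 1 / 2)
    (hm : δ ^ 3 * (n + 1 / 2) = 1) {s : ℝ} (hs : |s| * δ ≤ 4) (v : ℝ) :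
    ‖oscLine n δ 2 s v‖ ≤ Real.exp (|s| - 2 * s + 8 - v ^ 2 / 2) := by
  refine (norm_oscLine_le hδ hδ2 hm le_rfl s v).trans (Real.exp_le_exp.2 ?_)
  have h1 : s ^ 2 * δ / 4 ≤ |s| := by
    rw [← sq_abs]; nlinarith [abs_nonneg s]
  have h2 : Real.log (1 + δ * 2) - δ * 2 + (δ * 2) ^ 2 / 2 ≤ (δ * 2) ^ 3 := by
    have h3 := norm_log_one_add_sub_logTaylor_le (p := ((δ * 2 : ℝ) : ℂ)) (by simpa using hδ.le) 2
    rw [logTaylor_three, Complex.norm_real, Real.norm_of_nonneg (by positivity)] at h3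
    norm_num only at h3
    rw [show (1 + ((δ * 2 : ℝ) : ℂ)) = ((1 + δ * 2 : ℝ) : ℂ) by push_cast; ring,
      ← Complex.ofReal_log (by positivity)] at h3
    norm_cast at h3
    rw [Real.norm_eq_abs] at h3
    have := (abs_le.1 h3).2
    linarith
  have h4 : (n + 1 / 2) * (Real.log (1 + δ * 2) - δ * 2 + (δ * 2) ^ 2 / 2) ≤ 8 :=
    calc _ ≤ (n + 1 / 2) * (δ * 2) ^ 3 := by gcongr
      _ = 8 := by linear_combination 8 * hm
  linarith

lemma norm_oscLine_sub_airyLine_le {n : ℕ} {δ : ℝ} (hδ : 0 < δ) (hδ2 : δ ≤ 1 / 2)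
    (hm : δ ^ 3 * (n + 1 / 2) = 1) {s : ℝ} (hs : |s| * δ ≤ 4) (v : ℝ) :
    ‖oscLine n δ 2 s v - airyLine 2 s v -
        airyLine 2 s v * oscExponentLead δ s ((2 : ℝ) + v * Complex.I)‖ ≤
      6 * δ ^ 2 * (1 + s ^ 2) ^ 2 * Real.exp (|s| - 2 * s + 8) *
        ((2 + |v|) ^ 8 * Real.exp (-(1 / 2) * v ^ 2)) := by
  set w : ℂ := (2 : ℝ) + v * Complex.I with hw
  set t := 2 + |v| with ht
  have ht2 : 2 ≤ t := by rw [ht]; linarith [abs_nonneg v]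
  have hwt : ‖w‖ ≤ t := by
    have := norm_add_mul_I_le 2 v
    rwa [abs_two] at this
  have hw0 : 0 ≤ w.re := by simp [hw]
  set M := Real.exp (|s| - 2 * s + 8 - v ^ 2 / 2) with hM
  have hA := norm_airyLine_two_le s v
  have hO := norm_oscLine_two_le hδ hδ2 hm hs v
  have hOA := oscLine_eq hδ two_pos n s v
  rw [← hw] at hOA
  have hD := norm_oscExponent_le hδ hm s hw0
  have hDL := norm_oscExponent_sub_lead_le hδ hm s hw0
  set D := oscExponent n δ s w
  set D1 := oscExponentLead δ s w
  have hD' : ‖D‖ ≤ 2 * δ * t ^ 4 * (1 + s ^ 2) := by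
    refine hD.trans ?_
    have h1 : ‖w‖ ^ 4 + ‖w‖ + s ^ 2 ≤ t ^ 4 + t ^ 4 + s ^ 2 * (2 * t ^ 4) := by
      have h2 : t ≤ t ^ 4 := le_self_pow₀ (by linarith) (by norm_num)
      gcongr
      · exact hwt.trans h2
      · nlinarith [sq_nonneg s]
    calc _ ≤ δ * (t ^ 4 + t ^ 4 + s ^ 2 * (2 * t ^ 4)) := by gcongr
      _ = _ := by ring
  have hDL' : ‖D - D1‖ ≤ 2 * δ ^ 2 * t ^ 8 := by
    refine hDL.trans ?_
    have h1 : ‖w‖ ^ 5 + ‖w‖ ^ 2 ≤ t ^ 8 + t ^ 8 := by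
      have h2 : t ^ 5 ≤ t ^ 8 := pow_le_pow_right₀ (by linarith) (by norm_num)
      have h3 : t ^ 2 ≤ t ^ 8 := pow_le_pow_right₀ (by linarith) (by norm_num)
      exact add_le_add ((pow_le_pow_left₀ (norm_nonneg _) hwt 5).trans h2)
        ((pow_le_pow_left₀ (norm_nonneg _) hwt 2).trans h3)
    calc _ ≤ δ ^ 2 * (t ^ 8 + t ^ 8) := by gcongr
      _ = _ := by ring
  have hmax : ‖airyLine 2 s v‖ * max 1 (Real.exp D.re) ≤ M := by
    rw [mul_max_of_nonneg _ _ (norm_nonneg _), mul_one, ← Complex.norm_exp, ← norm_mul, ← hOA]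
    exact max_le hA hO
  have hsplit : oscLine n δ 2 s v - airyLine 2 s v - airyLine 2 s v * D1 =
      airyLine 2 s v * (Complex.exp D - 1 - D) + airyLine 2 s v * (D - D1) := by
    rw [hOA]; ring
  have hMe : M = Real.exp (|s| - 2 * s + 8) * Real.exp (-(1 / 2) * v ^ 2) := by
    rw [hM, ← Real.exp_add]; ring_nf
  rw [hsplit]
  have hM0 : 0 ≤ M := (Real.exp_pos _).le
  calc _ ≤ ‖airyLine 2 s v‖ * (‖D‖ ^ 2 * max 1 (Real.exp D.re)) +
        ‖airyLine 2 s v‖ * ‖D - D1‖ := by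
        refine (norm_add_le _ _).trans ?_
        rw [norm_mul, norm_mul]
        gcongr
        exact norm_exp_sub_one_sub_id_le_max D
    _ = ‖D‖ ^ 2 * (‖airyLine 2 s v‖ * max 1 (Real.exp D.re)) +
        ‖airyLine 2 s v‖ * ‖D - D1‖ := by ring
    _ ≤ (2 * δ * t ^ 4 * (1 + s ^ 2)) ^ 2 * M + M * (2 * δ ^ 2 * t ^ 8) := by gcongr
    _ = (4 * (1 + s ^ 2) ^ 2 + 2) * (δ ^ 2 * t ^ 8 * M) := by ring
    _ ≤ (6 * (1 + s ^ 2) ^ 2) * (δ ^ 2 * t ^ 8 * M) := by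
        gcongr
        nlinarith [sq_nonneg s, sq_nonneg (s ^ 2)]
    _ = _ := by rw [hMe]; ring

lemma integral_airyLine_mul_lead {σ : ℝ} (hσ : 0 < σ) (δ s : ℝ) :
    Integrable (fun v : ℝ => airyLine σ s v * oscExponentLead δ s (σ + v * Complex.I)) ∧
      ∫ v : ℝ, airyLine σ s v * oscExponentLead δ s (σ + v * Complex.I) = 0 := by
  have hpow : ∀ k : ℕ, Integrable fun v : ℝ =>
      (σ + v * Complex.I : ℂ) ^ k * airyLine σ s v := by
    intro k
    refine Integrable.mono' ((integrable_pow_mul_exp_neg_sq (abs_nonneg σ) hσ k).const_mul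
      (Real.exp (σ ^ 3 / 3 - s * σ)))
      (((by fun_prop : Continuous fun v : ℝ => (σ + v * Complex.I : ℂ) ^ k).mul
        (continuous_airyLine σ s)).aestronglyMeasurable) (.of_forall fun v => ?_)
    rw [norm_mul, norm_pow, norm_airyLine, sub_eq_add_neg _ (σ * v ^ 2), Real.exp_add,
      neg_mul, mul_left_comm]
    gcongr
    exact norm_add_mul_I_le σ v
  have h1 : Integrable fun v : ℝ =>
      airyLine σ s v * oscExponentLead δ s (σ + v * Complex.I) := by
    refine ((((hpow 4).const_mul (-δ / 4 : ℂ)).add ((hpow 1).const_mul (-δ / 2 : ℂ))).add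
      ((hpow 0).const_mul (δ * s ^ 2 / 4 : ℂ))).congr (.of_forall fun v => ?_)
    simp only [Pi.add_apply, oscExponentLead]
    ring
  refine ⟨h1, ?_⟩
  have h2 : Integrable fun v : ℝ => Complex.I * δ / 4 *
      (((σ + v * Complex.I : ℂ) ^ 2 + s) * airyLine σ s v) := by
    refine (((hpow 2).add ((hpow 0).const_mul (s : ℂ))).const_mul (Complex.I * δ / 4)).congr
      (.of_forall fun v => ?_)
    simp only [Pi.add_apply]
    ring
  refine integral_eq_zero_of_hasDerivAt_of_integrable (fun v => ?_) h1 h2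
  have hw : HasDerivAt (fun v : ℝ => (σ + v * Complex.I : ℂ)) Complex.I v := by
    simpa using ((Complex.ofRealCLM.hasDerivAt (x := v)).mul_const Complex.I).const_add (σ : ℂ)
  have hA : HasDerivAt (airyLine σ s)
      (airyLine σ s v * (3 * (σ + v * Complex.I) ^ 2 * Complex.I / 3 - s * Complex.I)) v := by
    unfold airyLine
    simpa using (((hw.pow 3).div_const 3).sub (hw.const_mul (s : ℂ))).cexp
  refine ((((hw.pow 2).add_const (s : ℂ)).mul hA).const_mul (Complex.I * δ / 4)).congr_deriv ?_
  simp only [oscExponentLead, Pi.pow_apply]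
  push_cast
  linear_combination (δ * airyLine σ s v / 4 * (2 * (σ + v * Complex.I) +
    (σ + v * Complex.I) ^ 4 - s ^ 2)) * Complex.I_sq

/-- Airy approximation of the contour integral, away from the far right tail. -/
lemma abs_integral_oscLine_sub_airyLine_le : ∃ C > 0, ∀ (n : ℕ) (δ : ℝ), 0 < δ → δ ≤ 1 / 2 →
    δ ^ 3 * (n + 1 / 2) = 1 → ∀ s : ℝ, |s| * δ ≤ 4 →
    |(∫ v, oscLine n δ 2 s v).re - (∫ v, airyLine 2 s v).re| ≤
      C * (δ ^ 2 * (1 + s ^ 2) ^ 2 * Real.exp (|s| - 2 * s)) := by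
  set J := ∫ v : ℝ, (2 + |v|) ^ 8 * Real.exp (-(1 / 2) * v ^ 2) with hJ
  have hJ0 : 0 ≤ J := integral_nonneg fun v => by positivity
  refine ⟨6 * Real.exp 8 * J + 1, by positivity, fun n δ hδ hδ2 hm s hs => ?_⟩
  have hO := integrable_oscLine hδ hδ2 hm le_rfl s
  have hA := integrable_airyLine two_pos s
  obtain ⟨hL, hL0⟩ := integral_airyLine_mul_lead two_pos δ s
  have h1 : (∫ v, oscLine n δ 2 s v) - ∫ v, airyLine 2 s v =
      ∫ v : ℝ, (oscLine n δ 2 s v - airyLine 2 s v -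
        airyLine 2 s v * oscExponentLead δ s ((2 : ℝ) + v * Complex.I)) := by
    have hOA : Integrable fun v => oscLine n δ 2 s v - airyLine 2 s v := hO.sub hA
    rw [integral_sub hOA hL, hL0, sub_zero, integral_sub hO hA]
  rw [← Complex.sub_re, h1]
  refine (Complex.abs_re_le_norm _).trans ?_
  refine (norm_integral_le_of_norm_le (((integrable_pow_mul_exp_neg_sq two_pos.le
    (by norm_num : (0 : ℝ) < 1 / 2) 8)).const_mul _) (.of_forall fun v =>
      norm_oscLine_sub_airyLine_le hδ hδ2 hm hs v)).trans ?_
  rw [integral_const_mul, ← hJ, Real.exp_add]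
  have h2 : 0 ≤ δ ^ 2 * (1 + s ^ 2) ^ 2 * Real.exp (|s| - 2 * s) := by positivity
  nlinarith

/-- Constant in front of the rescaled contour integral for `osc n`. -/
noncomputable def oscConst (n : ℕ) (δ : ℝ) : ℝ :=
  hNorm n ^ (-(1 : ℝ) / 2) * (2 ^ n / Real.sqrt Real.pi) *
    ((Real.sqrt (2 * n + 1) / 2) ^ (n + 1) * δ * Real.exp (-(n + 1 / 2) / 2))

lemma oscConst_pos (n : ℕ) {δ : ℝ} (hδ : 0 < δ) : 0 < oscConst n δ := by
  have : 0 < hNorm n := by unfold hNorm; positivity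
  unfold oscConst
  positivity

lemma osc_eq_integral_gaussLine (n : ℕ) (c x : ℝ) :
    (osc n x : ℂ) = ((hNorm n ^ (-(1 : ℝ) / 2) * (2 ^ n / Real.sqrt Real.pi) : ℝ) : ℂ) *
      ∫ y, Complex.exp ((x : ℂ) ^ 2 / 2) * gaussLine c n x y := by
  have h := iteratedDeriv_gauss_eq_integral c n x
  have he : Complex.exp ((x : ℂ) ^ 2 / 2) =
      ((Real.exp (-x ^ 2 / 2) * Real.exp (x ^ 2) : ℝ) : ℂ) := by
    rw [← Real.exp_add]
    push_cast
    ring_nf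
  have h2 : (-2 : ℂ) ^ n = (-1) ^ n * 2 ^ n := by rw [← mul_pow]; norm_num
  have h3 : ((-1 : ℂ) ^ n) * (-1) ^ n = 1 := by rw [← mul_pow]; norm_num
  rw [integral_const_mul, he, osc, physHermite]
  push_cast at h ⊢
  rw [h, h2]
  linear_combination ((hNorm n ^ (-(1 : ℝ) / 2) : ℝ) : ℂ) * Complex.exp (-(x : ℂ) ^ 2 / 2) *
    Complex.exp ((x : ℂ) ^ 2) * 2 ^ n / (Real.sqrt Real.pi : ℂ) * (∫ y, gaussLine c n x y) * h3

/-- Contour integral for the oscillator wave functions near the turning point. -/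
lemma osc_eq_oscConst_mul_integral {n : ℕ} {δ τ : ℝ} (hδ : 0 < δ)
    (hm : δ ^ 3 * (n + 1 / 2) = 1) (hτ : 0 < τ) (hτδ : τ ^ 2 = δ / 2) (σ s : ℝ) :
    osc n (Real.sqrt (2 * n + 1) + s * τ) = oscConst n δ * (∫ v, oscLine n δ σ s v).re := by
  set u := Real.sqrt (2 * n + 1) with hu
  have hu0 : 0 < u := Real.sqrt_pos.2 (by positivity)
  have hu2 : u ^ 2 = 2 * n + 1 := Real.sq_sqrt (by positivity)
  have huτ : u * τ * δ = 1 := by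
    have h1 : (u * τ * δ) ^ 2 = 1 := by
      rw [mul_pow, mul_pow, hu2, hτδ]; linear_combination hm
    have h2 : 0 < u * τ * δ := by positivity
    nlinarith
  set x := u + s * τ with hx
  have hscale : ∀ v : ℝ, Complex.exp ((x : ℂ) ^ 2 / 2) *
      gaussLine (u / 2 * (1 + δ * σ)) n x (u / 2 * δ * v) =
        (((u / 2) ^ n * Real.exp (-(n + 1 / 2) / 2) : ℝ) : ℂ) * oscLine n δ σ s v := by
    intro v
    have hz : ((u / 2 * (1 + δ * σ) : ℝ) : ℂ) + ((u / 2 * δ * v : ℝ) : ℂ) * Complex.I =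
        (u / 2 : ℂ) * (1 + δ * (σ + v * Complex.I)) := by
      push_cast; ring
    rw [gaussLine, hz, oscLine, mul_pow]
    set w : ℂ := σ + v * Complex.I
    have hu2c : (u : ℂ) ^ 2 = 2 * n + 1 := by
      have h := congrArg Complex.ofReal hu2
      push_cast at h
      exact h
    have huτc : (u : ℂ) * τ * δ = 1 := by
      have h := congrArg Complex.ofReal huτ
      push_cast at h
      exact h
    have hτδc : (τ : ℂ) ^ 2 = δ / 2 := by
      have h := congrArg Complex.ofReal hτδ
      push_cast at h
      exact h
    have hexp : Complex.exp ((x : ℂ) ^ 2 / 2) *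
        Complex.exp ((u / 2 * (1 + δ * w)) ^ 2 - 2 * (u / 2 * (1 + δ * w)) * x) =
        Complex.exp (-(n + 1 / 2) / 2) * Complex.exp (s ^ 2 * δ / 4 + (n + 1 / 2) *
          (-(δ * w) + (δ * w) ^ 2 / 2) - s * w) := by
      rw [← Complex.exp_add, ← Complex.exp_add]
      congr 1
      rw [hx]
      push_cast
      linear_combination (-1 / 4 - δ * w / 2 + δ ^ 2 * w ^ 2 / 4) * hu2c - s * w * huτc +
        s ^ 2 / 2 * hτδc
    push_cast
    linear_combination ((u / 2 : ℂ) ^ n * (1 + δ * w) ^ n) * hexp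
  have hscale0 : 0 < u / 2 * δ := by positivity
  have hsub := Measure.integral_comp_mul_left (fun y => Complex.exp ((x : ℂ) ^ 2 / 2) *
      gaussLine (u / 2 * (1 + δ * σ)) n x y) (u / 2 * δ)
  simp_rw [hscale] at hsub
  rw [integral_const_mul, abs_of_pos (inv_pos.2 hscale0), Complex.real_smul] at hsub
  have h1 := osc_eq_integral_gaussLine n (u / 2 * (1 + δ * σ)) x
  have h2 : ∫ y, Complex.exp ((x : ℂ) ^ 2 / 2) * gaussLine (u / 2 * (1 + δ * σ)) n x y =
      ((u / 2 * δ * ((u / 2) ^ n * Real.exp (-(n + 1 / 2) / 2)) : ℝ) : ℂ) *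
        ∫ v, oscLine n δ σ s v := by
    rw [Complex.ofReal_mul, mul_assoc, hsub, ← mul_assoc, ← Complex.ofReal_mul,
      mul_inv_cancel₀ hscale0.ne', Complex.ofReal_one, one_mul]
  rw [h2, ← mul_assoc, ← Complex.ofReal_mul] at h1
  have h3 := congrArg Complex.re h1
  rw [Complex.ofReal_re, Complex.re_ofReal_mul] at h3
  rw [h3, oscConst, ← hu]
  ring

lemma log_stirlingSeq_le {n : ℕ} (hn : n ≠ 0) :
    Real.log (Stirling.stirlingSeq n) ≤ Real.log (Real.sqrt Real.pi) + 1 / (2 * n) := by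
  have hmono : Monotone fun k : ℕ =>
      Real.log (Stirling.stirlingSeq (k + 1)) - 1 / (2 * ((k : ℝ) + 1)) := by
    refine monotone_nat_of_le_succ fun k => ?_
    have h := Stirling.log_stirlingSeq_sdiff_le (k + 1)
    have h2 : (1 : ℝ) / (12 * ((k : ℝ) + 1) * ((k : ℝ) + 1 + 1)) ≤
        1 / (2 * ((k : ℝ) + 1)) - 1 / (2 * ((k : ℝ) + 1 + 1)) := by
      rw [div_sub_div _ _ (by positivity) (by positivity), div_le_div_iff₀ (by positivity)
        (by positivity)]
      have : (0 : ℝ) ≤ k := by positivity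
      nlinarith [mul_nonneg this this, mul_nonneg this (mul_nonneg this this)]
    push_cast at h ⊢
    linarith
  have hlim : Tendsto (fun k : ℕ =>
      Real.log (Stirling.stirlingSeq (k + 1)) - 1 / (2 * ((k : ℝ) + 1))) atTop
      (nhds (Real.log (Real.sqrt Real.pi) - 0)) := by
    refine Tendsto.sub ?_ ?_
    · exact ((Stirling.tendsto_stirlingSeq_sqrt_pi.comp (tendsto_add_atTop_nat 1))).log
        (Real.sqrt_pos.2 Real.pi_pos).ne'
    · have h := (tendsto_one_div_add_atTop_nhds_zero_nat (𝕜 := ℝ)).const_mul (1 / 2)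
      rw [mul_zero] at h
      refine h.congr fun k => ?_
      field_simp
  obtain ⟨k, rfl⟩ := Nat.exists_eq_succ_of_ne_zero hn
  have h := hmono.ge_of_tendsto hlim k
  push_cast
  linarith

/-- Stirling's formula centred at `n + 1 / 2`, with a rate. -/
lemma abs_log_factorial_sub_le {n : ℕ} (hn : n ≠ 0) :
    |1 / 2 * Real.log (2 * Real.pi) + (n + 1 / 2) * Real.log (n + 1 / 2) - (n + 1 / 2) -
      Real.log n.factorial| ≤ 1 / n := by
  have hn0 : (0 : ℝ) < n := by positivity
  have h1 := log_stirlingSeq_le hn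
  have h2 : Real.log (Real.sqrt Real.pi) ≤ Real.log (Stirling.stirlingSeq n) :=
    Real.log_le_log (Real.sqrt_pos.2 Real.pi_pos) (Stirling.sqrt_pi_le_stirlingSeq hn)
  have h3 := Stirling.log_stirlingSeq_formula n
  rw [Real.log_mul two_ne_zero hn0.ne', Real.log_div hn0.ne' (Real.exp_pos 1).ne',
    Real.log_exp] at h3
  have h4 : Real.log (2 * Real.pi) = Real.log 2 + 2 * Real.log (Real.sqrt Real.pi) := by
    rw [Real.log_mul two_ne_zero Real.pi_pos.ne', Real.log_sqrt Real.pi_pos.le]; ring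
  have h5 : Real.log (n + 1 / 2) - Real.log n ≤ 1 / (2 * n) := by
    rw [← Real.log_div (by positivity) hn0.ne']
    refine (Real.log_le_sub_one_of_pos (by positivity)).trans (le_of_eq ?_)
    field_simp
    ring
  have h6 : 1 / (2 * (n + 1 / 2)) ≤ Real.log (n + 1 / 2) - Real.log n := by
    have h := Real.log_le_sub_one_of_pos (x := n / (n + 1 / 2)) (by positivity)
    rw [Real.log_div hn0.ne' (by positivity)] at h
    have h' : (n : ℝ) / (n + 1 / 2) - 1 = -(1 / (2 * (n + 1 / 2))) := by field_simp; ring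
    linarith
  have h7 : (n + 1 / 2 : ℝ) * (1 / (2 * n)) = 1 / 2 + 1 / n / 4 := by field_simp; ring
  have h8 : (n + 1 / 2 : ℝ) * (1 / (2 * (n + 1 / 2))) = 1 / 2 := by field_simp
  have h9 := mul_le_mul_of_nonneg_left h5 (by positivity : (0 : ℝ) ≤ n + 1 / 2)
  have h10 := mul_le_mul_of_nonneg_left h6 (by positivity : (0 : ℝ) ≤ n + 1 / 2)
  have h11 : (1 : ℝ) / (2 * n) = 1 / n / 2 := by field_simp
  have h12 : (0 : ℝ) < 1 / n := by positivity
  rw [h7] at h9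
  rw [h8] at h10
  rw [h11] at h1
  rw [abs_le]
  constructor <;> nlinarith

/-- Normalization of the oscillator wave functions against the Airy function. -/
lemma abs_prefactor_sub_one_le {N n : ℕ} (hN : 2 ≤ N) (h1 : (N : ℝ) - 1 / 2 ≤ n + 1 / 2)
    (h2 : (n + 1 / 2 : ℝ) ≤ N + 1 / 2) {δ : ℝ} (hδ : 0 < δ) (hm : δ ^ 3 * (n + 1 / 2) = 1) :
    |(2 * N : ℝ) ^ ((1 : ℝ) / 4) * tauN N * oscConst n δ * (2 * Real.pi) - 1| ≤ 4 / N := by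
  have hN2 : (2 : ℝ) ≤ N := by exact_mod_cast hN
  have hN0 : (0 : ℝ) < N := by linarith
  have hn0 : (0 : ℝ) < n := by linarith
  have hn : n ≠ 0 := by exact_mod_cast hn0.ne'
  have hm0 : (0 : ℝ) < n + 1 / 2 := by positivity
  have hpi := Real.pi_pos
  have hτ : 0 < tauN N := by unfold tauN; positivity
  have hc := oscConst_pos n hδ
  have hh : 0 < hNorm n := by unfold hNorm; positivity
  have hK : 0 < (2 * N : ℝ) ^ ((1 : ℝ) / 4) * tauN N * oscConst n δ * (2 * Real.pi) := by
    positivity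
  have lδ : Real.log δ = -(1 / 3) * Real.log (n + 1 / 2) := by
    have h := congrArg Real.log hm
    rw [Real.log_mul (by positivity) hm0.ne', Real.log_pow, Real.log_one] at h
    push_cast at h
    linarith
  have lu : Real.log (Real.sqrt (2 * n + 1) / 2) =
      1 / 2 * Real.log (n + 1 / 2) - 1 / 2 * Real.log 2 := by
    rw [Real.log_div (by positivity) two_ne_zero, Real.log_sqrt (by positivity),
      show (2 * n + 1 : ℝ) = 2 * (n + 1 / 2) by ring, Real.log_mul two_ne_zero hm0.ne']
    ring
  have lh : Real.log (hNorm n) =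
      1 / 2 * Real.log Real.pi + n * Real.log 2 + Real.log n.factorial := by
    rw [hNorm, Real.log_mul (by positivity) (by positivity), Real.log_mul (by positivity)
      (by positivity), Real.log_pow, Real.log_sqrt hpi.le]
    ring
  have lc : Real.log (oscConst n δ) = -(1 / 2) * (1 / 2 * Real.log Real.pi + n * Real.log 2 +
      Real.log n.factorial) + (n * Real.log 2 - 1 / 2 * Real.log Real.pi) +
      ((n + 1) * (1 / 2 * Real.log (n + 1 / 2) - 1 / 2 * Real.log 2) -
        1 / 3 * Real.log (n + 1 / 2) - (n + 1 / 2) / 2) := by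
    rw [oscConst, Real.log_mul (by positivity) (by positivity), Real.log_mul (by positivity)
      (by positivity), Real.log_rpow hh, lh, Real.log_div (by positivity) (by positivity),
      Real.log_pow, Real.log_sqrt hpi.le, Real.log_mul (by positivity) (by positivity),
      Real.log_mul (by positivity) (by positivity), Real.log_pow, lu, lδ, Real.log_exp]
    push_cast
    ring
  have lK : Real.log ((2 * N : ℝ) ^ ((1 : ℝ) / 4) * tauN N * oscConst n δ * (2 * Real.pi)) =
      1 / 12 * (Real.log N - Real.log (n + 1 / 2)) +
      1 / 2 * (1 / 2 * Real.log (2 * Real.pi) + (n + 1 / 2) * Real.log (n + 1 / 2) -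
        (n + 1 / 2) - Real.log n.factorial) := by
    rw [Real.log_mul (by positivity) (by positivity), Real.log_mul (by positivity)
      (by positivity), Real.log_mul (by positivity) (by positivity), lc, tauN,
      Real.log_mul (by positivity) (by positivity), Real.log_rpow (by positivity),
      Real.log_rpow (by positivity), Real.log_rpow (by positivity),
      Real.log_mul two_ne_zero hN0.ne', Real.log_mul two_ne_zero hpi.ne']
    ring
  have hS := abs_le.1 (abs_log_factorial_sub_le hn)
  have hnN : 1 / (n : ℝ) ≤ 2 / N := by
    rw [div_le_div_iff₀ hn0 hN0]; linarith
  have hl1 : Real.log N - Real.log (n + 1 / 2) ≤ 1 / N := by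
    rw [← Real.log_div hN0.ne' hm0.ne']
    refine (Real.log_le_sub_one_of_pos (by positivity)).trans ?_
    rw [div_sub_one hm0.ne', div_le_div_iff₀ hm0 hN0]
    nlinarith
  have hl2 : Real.log (n + 1 / 2) - Real.log N ≤ 1 / N := by
    rw [← Real.log_div hm0.ne' hN0.ne']
    refine (Real.log_le_sub_one_of_pos (by positivity)).trans ?_
    rw [div_sub_one hN0.ne', div_le_div_iff₀ hN0 hN0]
    nlinarith
  have hN1 : 1 / (N : ℝ) ≤ 1 / 2 := one_div_le_one_div_of_le two_pos hN2
  have h2N : 2 / (N : ℝ) = 2 * (1 / N) := by ring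
  have h4N : 4 / (N : ℝ) = 2 * (2 * (1 / N)) := by ring
  have habs : |Real.log ((2 * N : ℝ) ^ ((1 : ℝ) / 4) * tauN N * oscConst n δ * (2 * Real.pi))| ≤
      2 * (1 / N) := by
    rw [lK, abs_le]
    constructor <;> linarith
  have h := Real.abs_exp_sub_one_le (habs.trans (by linarith))
  rw [Real.exp_log hK] at h
  linarith

lemma abs_Ai_le : ∃ C > 0, ∀ s : ℝ, |Ai s| ≤ C * Real.exp (-2 * s) := by
  have hpow : Integrable fun v : ℝ => Real.exp (-2 * v ^ 2) := integrable_exp_neg_mul_sq two_pos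
  have hJ0 : 0 ≤ ∫ v : ℝ, Real.exp (-2 * v ^ 2) := integral_nonneg fun v => by positivity
  have hpi : 0 < (2 * Real.pi)⁻¹ := by have := Real.pi_pos; positivity
  refine ⟨(2 * Real.pi)⁻¹ * (Real.exp (8 / 3) * ∫ v : ℝ, Real.exp (-2 * v ^ 2)) + 1,
    by positivity, fun s => ?_⟩
  rw [Ai_eq_integral two_pos, abs_mul, abs_of_pos hpi]
  have h1 : ‖∫ v, airyLine 2 s v‖ ≤
      ∫ v : ℝ, Real.exp (8 / 3) * Real.exp (-2 * s) * Real.exp (-2 * v ^ 2) := by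
    refine norm_integral_le_of_norm_le (hpow.const_mul _) (.of_forall fun v => ?_)
    rw [norm_airyLine, ← Real.exp_add, ← Real.exp_add]
    exact Real.exp_le_exp.2 (by linarith)
  rw [integral_const_mul] at h1
  have h2 := (Complex.abs_re_le_norm _).trans h1
  have h3 := mul_le_mul_of_nonneg_left h2 hpi.le
  nlinarith [Real.exp_pos (-2 * s)]

lemma norm_airyLine_sub_le (s s' v : ℝ) :
    ‖airyLine 2 s' v - airyLine 2 s v‖ ≤ |s' - s| * max (Real.exp (-2 * s)) (Real.exp (-2 * s')) *
      (Real.exp (8 / 3) * ((2 + |v|) ^ 1 * Real.exp (-2 * v ^ 2))) := by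
  set w : ℂ := (2 : ℝ) + v * Complex.I with hw
  have hfac : airyLine 2 s' v = airyLine 2 s v * Complex.exp (((s - s' : ℝ) : ℂ) * w) := by
    rw [airyLine, airyLine, ← Complex.exp_add, hw]
    congr 1
    push_cast
    ring
  have hwn : ‖w‖ ≤ 2 + |v| := by
    have := norm_add_mul_I_le 2 v
    rwa [abs_two] at this
  have hA : ∀ s : ℝ, ‖airyLine 2 s v‖ =
      Real.exp (8 / 3) * Real.exp (-2 * v ^ 2) * Real.exp (-2 * s) := fun s => by
    rw [norm_airyLine, ← Real.exp_add, ← Real.exp_add]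
    ring_nf
  have h1 := norm_exp_sub_one_le_max (((s - s' : ℝ) : ℂ) * w)
  have hmax : ‖airyLine 2 s v‖ * max 1 (Real.exp (((s - s' : ℝ) : ℂ) * w).re) =
      Real.exp (8 / 3) * Real.exp (-2 * v ^ 2) *
        max (Real.exp (-2 * s)) (Real.exp (-2 * s')) := by
    rw [mul_max_of_nonneg _ _ (norm_nonneg _), mul_one, ← Complex.norm_exp, ← norm_mul, ← hfac,
      mul_max_of_nonneg _ _ (by positivity), hA, hA]
  rw [norm_mul, Complex.norm_real, Real.norm_eq_abs, abs_sub_comm] at h1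
  rw [hfac, ← mul_sub_one, norm_mul]
  calc _ ≤ ‖airyLine 2 s v‖ * (|s' - s| * ‖w‖ *
        max 1 (Real.exp (((s - s' : ℝ) : ℂ) * w).re)) := by gcongr
    _ = |s' - s| * ‖w‖ * (‖airyLine 2 s v‖ *
        max 1 (Real.exp (((s - s' : ℝ) : ℂ) * w).re)) := by ring
    _ ≤ |s' - s| * (2 + |v|) * (‖airyLine 2 s v‖ *
        max 1 (Real.exp (((s - s' : ℝ) : ℂ) * w).re)) := by gcongr
    _ = _ := by rw [hmax]; ring

lemma abs_Ai_sub_le : ∃ C > 0, ∀ s s' : ℝ,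
    |Ai s' - Ai s| ≤ C * (|s' - s| * max (Real.exp (-2 * s)) (Real.exp (-2 * s'))) := by
  set J := ∫ v : ℝ, Real.exp (8 / 3) * ((2 + |v|) ^ 1 * Real.exp (-2 * v ^ 2)) with hJ
  have hJ0 : 0 ≤ J := integral_nonneg fun v => by positivity
  have hpi : 0 < (2 * Real.pi)⁻¹ := by have := Real.pi_pos; positivity
  refine ⟨(2 * Real.pi)⁻¹ * J + 1, by positivity, fun s s' => ?_⟩
  rw [Ai_eq_integral two_pos, Ai_eq_integral two_pos, ← mul_sub, ← Complex.sub_re,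
    ← integral_sub (integrable_airyLine two_pos s') (integrable_airyLine two_pos s), abs_mul,
    abs_of_pos hpi]
  have h1 := norm_integral_le_of_norm_le
    (((integrable_pow_mul_exp_neg_sq two_pos.le two_pos 1).const_mul (Real.exp (8 / 3))).const_mul
      (|s' - s| * max (Real.exp (-2 * s)) (Real.exp (-2 * s'))))
    (.of_forall fun v => norm_airyLine_sub_le s s' v)
  rw [integral_const_mul, ← hJ] at h1
  have h2 := mul_le_mul_of_nonneg_left ((Complex.abs_re_le_norm _).trans h1) hpi.le
  have h3 : 0 ≤ |s' - s| * max (Real.exp (-2 * s)) (Real.exp (-2 * s')) := by positivity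
  nlinarith

/-- Bound for the contour integral in the far right tail, through the line of abscissa `s δ`. -/
lemma abs_integral_oscLine_le_of_tail {n : ℕ} {δ : ℝ} (hδ : 0 < δ) (hδ2 : δ ≤ 1 / 2)
    (hm : δ ^ 3 * (n + 1 / 2) = 1) {s : ℝ} (hs : 4 ≤ s * δ) :
    |(∫ v, oscLine n δ 2 s v).re| ≤
      (∫ v : ℝ, Real.exp (-(1 / 2) * v ^ 2)) * Real.exp (-s) := by
  have hs0 : 0 < s := by
    by_contra h
    nlinarith [mul_nonneg (neg_nonneg.2 (not_lt.1 h)) hδ.le]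
  have hτ : (Real.sqrt (δ / 2)) ^ 2 = δ / 2 := Real.sq_sqrt (by positivity)
  have hτ0 : 0 < Real.sqrt (δ / 2) := Real.sqrt_pos.2 (by positivity)
  have hshift : (∫ v, oscLine n δ 2 s v).re = (∫ v, oscLine n δ (s * δ) s v).re :=
    mul_left_cancel₀ (oscConst_pos n hδ).ne'
      ((osc_eq_oscConst_mul_integral hδ hm hτ0 hτ 2 s).symm.trans
        (osc_eq_oscConst_mul_integral hδ hm hτ0 hτ (s * δ) s))
  rw [hshift, mul_comm _ (Real.exp (-s)), ← integral_const_mul]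
  refine (Complex.abs_re_le_norm _).trans (norm_integral_le_of_norm_le
    ((integrable_exp_neg_mul_sq (by norm_num)).const_mul _) (.of_forall fun v => ?_))
  refine (norm_oscLine_le hδ hδ2 hm (by linarith) s v).trans ?_
  rw [← Real.exp_add]
  refine Real.exp_le_exp.2 ?_
  have h1 := Real.log_le_sub_one_of_pos (x := 1 + δ * (s * δ)) (by positivity)
  have h2 : (n + 1 / 2) * (Real.log (1 + δ * (s * δ)) - δ * (s * δ) + (δ * (s * δ)) ^ 2 / 2) ≤
      s ^ 2 * δ / 2 :=
    calc _ ≤ (n + 1 / 2) * ((δ * (s * δ)) ^ 2 / 2) := by gcongr; linarith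
      _ = _ := by linear_combination s ^ 2 * δ / 2 * hm
  nlinarith

lemma sq_one_add_sq_mul_exp_le {B s : ℝ} (hB : -B ≤ s) (hB0 : 0 ≤ B) :
    (1 + s ^ 2) ^ 2 * Real.exp (|s| - 2 * s) ≤
      6144 * Real.exp (1 + 5 / 2 * B) * Real.exp (-3 / 4 * s) := by
  have h0 := abs_nonneg s
  have h1 : (1 + s ^ 2) ^ 2 ≤ 256 * (1 + |s| / 4) ^ 4 := by
    have h : 1 + s ^ 2 ≤ 16 * (1 + |s| / 4) ^ 2 := by rw [← sq_abs]; nlinarith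
    calc _ ≤ (16 * (1 + |s| / 4) ^ 2) ^ 2 := by gcongr
      _ = _ := by ring
  have h2 := Real.pow_div_factorial_le_exp (1 + |s| / 4) (by positivity) 4
  rw [div_le_iff₀ (by positivity), show ((4 : ℕ).factorial : ℝ) = 24 by norm_num [Nat.factorial]]
    at h2
  have h3 : |s| - s ≤ 2 * B := by
    rcases abs_cases s with h | h <;> linarith
  calc (1 + s ^ 2) ^ 2 * Real.exp (|s| - 2 * s)
      ≤ 256 * (Real.exp (1 + |s| / 4) * 24) * Real.exp (|s| - 2 * s) := by
        gcongr
        exact h1.trans (by gcongr)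
    _ = 6144 * Real.exp ((1 + |s| / 4) + (|s| - 2 * s)) := by
        rw [Real.exp_add (1 + |s| / 4)]; ring
    _ ≤ 6144 * Real.exp ((1 + 5 / 2 * B) + -3 / 4 * s) := by
        refine mul_le_mul_of_nonneg_left (Real.exp_le_exp.2 ?_) (by norm_num)
        linarith
    _ = _ := by rw [Real.exp_add (1 + 5 / 2 * B)]; ring

/-- Airy approximation of the contour integral, uniformly on right half lines. -/
lemma abs_integral_oscLine_sub_Ai_le {B : ℝ} (hB : 0 ≤ B) : ∃ C > 0, ∀ (n : ℕ) (δ : ℝ), 0 < δ →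
    δ ≤ 1 / 2 → B * δ ≤ 4 → δ ^ 3 * (n + 1 / 2) = 1 → ∀ s : ℝ, -B ≤ s →
    |(2 * Real.pi)⁻¹ * (∫ v, oscLine n δ 2 s v).re - Ai s| ≤
      C * (δ ^ 2 * Real.exp (-3 / 4 * s)) := by
  obtain ⟨C₁, hC₁, h₁⟩ := abs_integral_oscLine_sub_airyLine_le
  obtain ⟨C₂, hC₂, h₂⟩ := abs_Ai_le
  have hpi : 0 < (2 * Real.pi)⁻¹ := by have := Real.pi_pos; positivity
  set J := ∫ v : ℝ, Real.exp (-(1 / 2) * v ^ 2) with hJ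
  have hJ0 : 0 ≤ J := integral_nonneg fun v => by positivity
  refine ⟨(2 * Real.pi)⁻¹ * (C₁ * (6144 * Real.exp (1 + 5 / 2 * B))) +
    2 * ((2 * Real.pi)⁻¹ * J + C₂), by positivity, fun n δ hδ hδ2 hBδ hm s hs => ?_⟩
  have hE : 0 ≤ δ ^ 2 * Real.exp (-3 / 4 * s) := by positivity
  rcases le_or_gt (|s| * δ) 4 with h | h
  · rw [Ai_eq_integral two_pos, ← mul_sub, abs_mul, abs_of_pos hpi]
    calc _ ≤ (2 * Real.pi)⁻¹ * (C₁ * (δ ^ 2 * (1 + s ^ 2) ^ 2 * Real.exp (|s| - 2 * s))) := by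
          gcongr
          exact h₁ n δ hδ hδ2 hm s h
      _ = (2 * Real.pi)⁻¹ * (C₁ * (δ ^ 2 * ((1 + s ^ 2) ^ 2 * Real.exp (|s| - 2 * s)))) := by ring
      _ ≤ (2 * Real.pi)⁻¹ * (C₁ * (δ ^ 2 *
          (6144 * Real.exp (1 + 5 / 2 * B) * Real.exp (-3 / 4 * s)))) := by
          have := sq_one_add_sq_mul_exp_le hs hB
          gcongr
      _ = (2 * Real.pi)⁻¹ * (C₁ * (6144 * Real.exp (1 + 5 / 2 * B))) *
          (δ ^ 2 * Real.exp (-3 / 4 * s)) := by ring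
      _ ≤ _ := by
          gcongr
          have : 0 ≤ 2 * ((2 * Real.pi)⁻¹ * J + C₂) := by positivity
          linarith
  · have hs0 : 0 < s := by
      by_contra h'
      rw [abs_of_nonpos (not_lt.1 h')] at h
      have : -s * δ ≤ B * δ := by gcongr; linarith
      linarith
    rw [abs_of_pos hs0] at h
    have h3 : Real.exp (-s) ≤ 2 * (δ ^ 2 * Real.exp (-3 / 4 * s)) := by
      have h4 := Real.pow_div_factorial_le_exp (1 / δ) (by positivity) 2
      have h5 : 1 / δ ≤ s / 4 := by rw [div_le_div_iff₀ hδ (by norm_num)]; linarith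
      have h6 : 1 ≤ 2 * δ ^ 2 * Real.exp (s / 4) := by
        have h7 : (1 / δ) ^ 2 / 2 ≤ Real.exp (s / 4) := by
          refine le_trans ?_ (Real.exp_le_exp.2 h5)
          simpa using h4
        calc (1 : ℝ) = 2 * δ ^ 2 * ((1 / δ) ^ 2 / 2) := by field_simp
          _ ≤ _ := by gcongr
      calc Real.exp (-s) = 1 * Real.exp (-s) := (one_mul _).symm
        _ ≤ 2 * δ ^ 2 * Real.exp (s / 4) * Real.exp (-s) := by gcongr
        _ = 2 * (δ ^ 2 * Real.exp (s / 4 + -s)) := by rw [Real.exp_add]; ring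
        _ = _ := by ring_nf
    have h4 := abs_integral_oscLine_le_of_tail hδ hδ2 hm h.le
    have h5 : |Ai s| ≤ C₂ * Real.exp (-s) := (h₂ s).trans (by gcongr; linarith)
    refine (abs_sub _ _).trans ?_
    rw [abs_mul, abs_of_pos hpi]
    calc _ ≤ (2 * Real.pi)⁻¹ * (J * Real.exp (-s)) + C₂ * Real.exp (-s) := by gcongr
      _ = ((2 * Real.pi)⁻¹ * J + C₂) * Real.exp (-s) := by ring
      _ ≤ ((2 * Real.pi)⁻¹ * J + C₂) * (2 * (δ ^ 2 * Real.exp (-3 / 4 * s))) := by gcongr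
      _ = 2 * ((2 * Real.pi)⁻¹ * J + C₂) * (δ ^ 2 * Real.exp (-3 / 4 * s)) := by ring
      _ ≤ _ := by
          gcongr
          have : 0 ≤ (2 * Real.pi)⁻¹ * (C₁ * (6144 * Real.exp (1 + 5 / 2 * B))) := by positivity
          linarith

lemma abs_sub_one_le_of_pow_six {ρ η : ℝ} (hρ : 0 < ρ) (h : |ρ ^ 6 - 1| ≤ η) : |ρ - 1| ≤ η := by
  refine le_trans ?_ h
  rw [show ρ ^ 6 - 1 = (ρ - 1) * (1 + ρ + ρ ^ 2 + ρ ^ 3 + ρ ^ 4 + ρ ^ 5) by ring, abs_mul]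
  refine le_mul_of_one_le_right (abs_nonneg _) (le_trans ?_ (le_abs_self _))
  have : 0 ≤ ρ + ρ ^ 2 + ρ ^ 3 + ρ ^ 4 + ρ ^ 5 := by positivity
  linarith

lemma neg_le_mul_of_abs_sub_one_le {B ρ s : ℝ} (hB : -B ≤ s) (hB0 : 0 ≤ B)
    (hρ : |ρ - 1| ≤ 1 / 4) : -(5 / 4 * B) ≤ ρ * s := by
  obtain ⟨h1, h2⟩ := abs_le.1 hρ
  rcases le_total 0 s with h | h <;> nlinarith

lemma exp_mul_le_of_abs_sub_one_le {B ρ s : ℝ} (hB : -B ≤ s) (hB0 : 0 ≤ B)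
    (hρ : |ρ - 1| ≤ 1 / 4) :
    Real.exp (-3 / 4 * (ρ * s)) ≤ Real.exp B * Real.exp (-s / 2) := by
  have h0 := neg_le_mul_of_abs_sub_one_le hB hB0 hρ
  obtain ⟨h1, h2⟩ := abs_le.1 hρ
  rw [← Real.exp_add]
  refine Real.exp_le_exp.2 ?_
  rcases le_total 0 s with h | h <;> nlinarith

lemma exp_neg_two_mul_le_of_abs_sub_one_le {B ρ s : ℝ} (hB : -B ≤ s) (hB0 : 0 ≤ B)
    (hρ : |ρ - 1| ≤ 1 / 4) :
    Real.exp (-2 * (ρ * s)) ≤ Real.exp (5 / 2 * B - 3 / 2 * s) := by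
  have h0 := neg_le_mul_of_abs_sub_one_le hB hB0 hρ
  obtain ⟨h1, h2⟩ := abs_le.1 hρ
  refine Real.exp_le_exp.2 ?_
  rcases le_total 0 s with h | h <;> nlinarith

lemma abs_mul_sub_mul_max_exp_le {B ρ s η : ℝ} (hB : -B ≤ s) (hB0 : 0 ≤ B)
    (hρ : |ρ - 1| ≤ 1 / 4) (hη : |ρ - 1| ≤ η) :
    |ρ * s - s| * max (Real.exp (-2 * s)) (Real.exp (-2 * (ρ * s))) ≤
      η * (Real.exp (9 / 2 * B) * Real.exp (-s / 2)) := by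
  have h1 : max (Real.exp (-2 * s)) (Real.exp (-2 * (ρ * s))) ≤
      Real.exp (5 / 2 * B - 3 / 2 * s) :=
    max_le (Real.exp_le_exp.2 (by linarith)) (exp_neg_two_mul_le_of_abs_sub_one_le hB hB0 hρ)
  have h2 : |s| ≤ Real.exp (s + 2 * B) := by
    have h3 := Real.add_one_le_exp (s + 2 * B)
    rcases abs_cases s with h | h <;> linarith
  have h0 : 0 ≤ η := (abs_nonneg _).trans hη
  rw [show ρ * s - s = (ρ - 1) * s by ring, abs_mul]
  calc |ρ - 1| * |s| * max (Real.exp (-2 * s)) (Real.exp (-2 * (ρ * s)))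
      ≤ η * Real.exp (s + 2 * B) * Real.exp (5 / 2 * B - 3 / 2 * s) := by gcongr
    _ = _ := by rw [mul_assoc, ← Real.exp_add, ← Real.exp_add]; ring_nf

lemma tauN_pow_six {N : ℕ} (hN : N ≠ 0) : tauN N ^ 6 * (8 * N) = 1 := by
  have hN0 : (0 : ℝ) < N := by positivity
  rw [tauN, mul_pow, ← Real.rpow_natCast, ← Real.rpow_natCast, ← Real.rpow_mul two_pos.le,
    ← Real.rpow_mul hN0.le]
  norm_num
  rw [Real.rpow_neg_one]
  field_simp

/-- Airy approximation at fixed index, given the scale `δ` of the contour integral. -/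
lemma abs_prefactor_mul_osc_sub_Ai_le {B : ℝ} (hB0 : 0 ≤ B) : ∃ C > 0, ∀ (N n : ℕ) (δ : ℝ),
    2 ≤ N → (N : ℝ) - 1 / 2 ≤ n + 1 / 2 → (n + 1 / 2 : ℝ) ≤ N + 1 / 2 → 0 < δ → δ ≤ 1 / 2 →
    B * δ ≤ 2 → δ ^ 3 * (n + 1 / 2) = 1 → ∀ s : ℝ, -B ≤ s →
    |(2 * N : ℝ) ^ ((1 : ℝ) / 4) * tauN N * osc n (Real.sqrt (2 * n + 1) + s * tauN N) - Ai s| ≤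
      C * (1 / N + δ ^ 2) * Real.exp (-s / 2) := by
  obtain ⟨C₁, hC₁, h₁⟩ := abs_integral_oscLine_sub_Ai_le (B := 2 * B) (by positivity)
  obtain ⟨C₂, hC₂, h₂⟩ := abs_Ai_le
  obtain ⟨C₃, hC₃, h₃⟩ := abs_Ai_sub_le
  refine ⟨4 * C₂ * Real.exp (9 / 2 * B) + 3 * C₁ * Real.exp B + C₃ * Real.exp (9 / 2 * B),
    by positivity, fun N n δ hN hn1 hn2 hδ hδ2 hBδ hm s hs => ?_⟩
  have hN2 : (2 : ℝ) ≤ N := by exact_mod_cast hN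
  have hN0 : (0 : ℝ) < N := by linarith
  have hτN : 0 < tauN N := by unfold tauN; positivity
  set τ := Real.sqrt (δ / 2) with hτ
  have hτ0 : 0 < τ := Real.sqrt_pos.2 (by positivity)
  have hτ2 : τ ^ 2 = δ / 2 := Real.sq_sqrt (by positivity)
  set ρ := tauN N / τ with hρ
  have hρ6 : ρ ^ 6 = (n + 1 / 2) / N := by
    have h6 : τ ^ 6 = δ ^ 3 / 8 := by rw [show τ ^ 6 = (τ ^ 2) ^ 3 by ring, hτ2]; ring
    have h7 := tauN_pow_six (N := N) (by omega)
    rw [hρ, div_pow, h6, div_eq_div_iff (by positivity) (by positivity)]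
    linear_combination h7 / 8 - hm / 8
  have hN4 : 1 / (2 * N : ℝ) ≤ 1 / 4 := one_div_le_one_div_of_le (by norm_num) (by linarith)
  have hρ1 : |ρ - 1| ≤ 1 / (2 * N) := by
    refine abs_sub_one_le_of_pow_six (by positivity) ?_
    rw [hρ6, div_sub_one hN0.ne', abs_div, abs_of_pos hN0, div_le_div_iff₀ hN0 (by positivity)]
    have : |(n + 1 / 2 : ℝ) - N| ≤ 1 / 2 := abs_le.2 ⟨by linarith, by linarith⟩
    nlinarith
  have hρ4 := hρ1.trans hN4
  have hs' := neg_le_mul_of_abs_sub_one_le hs hB0 hρ4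
  have hsτ : s * tauN N = (ρ * s) * τ := by rw [hρ]; field_simp
  rw [hsτ, osc_eq_oscConst_mul_integral hδ hm hτ0 hτ2 2 (ρ * s)]
  have e₁ := h₁ n δ hδ hδ2 (by linarith) hm (ρ * s) (by linarith)
  have e₂ := h₂ (ρ * s)
  have e₃ := h₃ s (ρ * s)
  have e₄ := abs_prefactor_sub_one_le hN hn1 hn2 hδ hm
  set K := (2 * N : ℝ) ^ ((1 : ℝ) / 4) * tauN N * oscConst n δ * (2 * Real.pi) with hK
  set X := (2 * Real.pi)⁻¹ * (∫ v, oscLine n δ 2 (ρ * s) v).re with hX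
  have hKX : (2 * N : ℝ) ^ ((1 : ℝ) / 4) * tauN N *
      (oscConst n δ * (∫ v, oscLine n δ 2 (ρ * s) v).re) = K * X := by
    rw [hK, hX]
    have := Real.pi_pos.ne'
    field_simp
  rw [hKX]
  have f₁ := exp_mul_le_of_abs_sub_one_le hs hB0 hρ4
  have f₂ : Real.exp (-2 * (ρ * s)) ≤ Real.exp (9 / 2 * B) * Real.exp (-s / 2) := by
    refine (exp_neg_two_mul_le_of_abs_sub_one_le hs hB0 hρ4).trans ?_
    rw [← Real.exp_add]
    exact Real.exp_le_exp.2 (by linarith)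
  have f₃ := abs_mul_sub_mul_max_exp_le hs hB0 hρ4 hρ1
  have g₁ : |X - Ai (ρ * s)| ≤ C₁ * (δ ^ 2 * (Real.exp B * Real.exp (-s / 2))) :=
    e₁.trans (by gcongr)
  have g₂ : |Ai (ρ * s)| ≤ C₂ * (Real.exp (9 / 2 * B) * Real.exp (-s / 2)) :=
    e₂.trans (by gcongr)
  have g₃ : |Ai (ρ * s) - Ai s| ≤
      C₃ * (1 / N * (Real.exp (9 / 2 * B) * Real.exp (-s / 2))) := by
    refine e₃.trans (mul_le_mul_of_nonneg_left (f₃.trans ?_) hC₃.le)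
    gcongr
    linarith
  have hX' : |X| ≤ |X - Ai (ρ * s)| + |Ai (ρ * s)| := by
    simpa using abs_add_le (X - Ai (ρ * s)) (Ai (ρ * s))
  have hsplit : |K * X - Ai s| ≤ |K - 1| * |X| + |X - Ai (ρ * s)| + |Ai (ρ * s) - Ai s| := by
    rw [← abs_mul]
    refine le_trans (le_of_eq ?_) (abs_add_three _ _ _)
    ring_nf
  have hN24 : 4 / (N : ℝ) ≤ 2 := by rw [div_le_iff₀ hN0]; linarith
  have hnonneg : 0 ≤ (4 * C₂ * Real.exp (9 / 2 * B) + C₃ * Real.exp (9 / 2 * B)) * δ ^ 2 *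
      Real.exp (-s / 2) + 3 * C₁ * Real.exp B * (1 / N) * Real.exp (-s / 2) := by positivity
  calc |K * X - Ai s|
      ≤ |K - 1| * (|X - Ai (ρ * s)| + |Ai (ρ * s)|) + |X - Ai (ρ * s)| + |Ai (ρ * s) - Ai s| :=
        hsplit.trans (by gcongr)
    _ = |K - 1| * |X - Ai (ρ * s)| + |K - 1| * |Ai (ρ * s)| + |X - Ai (ρ * s)| +
        |Ai (ρ * s) - Ai s| := by ring
    _ ≤ 2 * (C₁ * (δ ^ 2 * (Real.exp B * Real.exp (-s / 2)))) +
        4 / N * (C₂ * (Real.exp (9 / 2 * B) * Real.exp (-s / 2))) +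
        C₁ * (δ ^ 2 * (Real.exp B * Real.exp (-s / 2))) +
        C₃ * (1 / N * (Real.exp (9 / 2 * B) * Real.exp (-s / 2))) := by
          have := e₄.trans hN24
          gcongr
    _ = (4 * C₂ * Real.exp (9 / 2 * B) + 3 * C₁ * Real.exp B + C₃ * Real.exp (9 / 2 * B)) *
        (1 / N + δ ^ 2) * Real.exp (-s / 2) -
        ((4 * C₂ * Real.exp (9 / 2 * B) + C₃ * Real.exp (9 / 2 * B)) * δ ^ 2 *
      Real.exp (-s / 2) + 3 * C₁ * Real.exp B * (1 / N) * Real.exp (-s / 2)) := by ring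
    _ ≤ _ := by linarith

/-- Airy approximation of the rescaled oscillator wave functions with rate `N^{-2/3}`:
for `j ∈ {N-1, N}`, `u_j = √(2j+1)`,
`|(2N)^{1/4} τ_N φ_j(u_j + s τ_N) - Ai(s)| ≤ C N^{-2/3} e^{-s/2}` for all `s ≥ s_L`. -/
theorem rescaled_osc_airy_approx (sL : ℝ) :
    ∃ C > 0, ∃ N₀ : ℕ, ∀ N : ℕ, N₀ ≤ N → ∀ j ∈ ({N - 1, N} : Set ℕ), ∀ s : ℝ, sL ≤ s →
      |(2 * N : ℝ) ^ ((1 : ℝ) / 4) * tauN N *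
          osc j (Real.sqrt (2 * j + 1) + s * tauN N) - Ai s| ≤
        C * (N : ℝ) ^ (-(2 : ℝ) / 3) * Real.exp (-s / 2) := by
  obtain ⟨C, hC, h⟩ := abs_prefactor_mul_osc_sub_Ai_le (abs_nonneg sL)
  refine ⟨C * 3, by positivity, max 9 (⌈|sL| ^ 3⌉₊ + 1), fun N hN j hj s hs => ?_⟩
  have hN9 : 9 ≤ N := (le_max_left _ _).trans hN
  have hNB : |sL| ^ 3 + 1 ≤ (N : ℝ) := by
    have h1 : ((⌈|sL| ^ 3⌉₊ + 1 : ℕ) : ℝ) ≤ N := by exact_mod_cast (le_max_right _ _).trans hN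
    push_cast at h1
    linarith [Nat.le_ceil (|sL| ^ 3)]
  have hN9' : (9 : ℝ) ≤ N := by exact_mod_cast hN9
  have hN0 : (0 : ℝ) < N := by linarith
  have hj1 : (N : ℝ) - 1 / 2 ≤ j + 1 / 2 ∧ (j + 1 / 2 : ℝ) ≤ N + 1 / 2 := by
    rcases hj with rfl | rfl
    · rw [Nat.cast_sub (by omega)]
      push_cast
      constructor <;> linarith
    · constructor <;> linarith
  have hm0 : (0 : ℝ) < j + 1 / 2 := by positivity
  obtain ⟨δ, hδ, hm⟩ : ∃ δ : ℝ, 0 < δ ∧ δ ^ 3 * (j + 1 / 2) = 1 := by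
    refine ⟨(j + 1 / 2 : ℝ) ^ (-(1 : ℝ) / 3), by positivity, ?_⟩
    rw [← Real.rpow_natCast, ← Real.rpow_mul hm0.le]
    norm_num
    rw [Real.rpow_neg_one]
    exact inv_mul_cancel₀ hm0.ne'
  have hδ2 : δ ≤ 1 / 2 := by
    by_contra! h'
    have : (1 / 2 : ℝ) ^ 3 < δ ^ 3 := by gcongr
    nlinarith
  have hBδ : |sL| * δ ≤ 2 := by
    by_contra! h'
    have h2 : (2 : ℝ) ^ 3 < (|sL| * δ) ^ 3 := by gcongr
    rw [mul_pow] at h2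
    have h3 : |sL| ^ 3 * δ ^ 3 ≤ (j + 1 / 2) * δ ^ 3 := by gcongr; linarith
    linarith
  set q := (N : ℝ) ^ (-(2 : ℝ) / 3) with hq
  have hq0 : 0 < q := by positivity
  have hq3 : q ^ 3 * N ^ 2 = 1 := by
    rw [hq, ← Real.rpow_natCast, ← Real.rpow_mul hN0.le, ← Real.rpow_natCast (N : ℝ) 2,
      ← Real.rpow_add hN0]
    norm_num
  have hNq : 1 / (N : ℝ) ≤ q := by
    rw [hq, one_div, ← Real.rpow_neg_one]
    exact Real.rpow_le_rpow_of_exponent_le (by linarith) (by norm_num)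
  have hδq : δ ^ 2 ≤ 2 * q := by
    refine (pow_le_pow_iff_left₀ (by positivity) (by positivity) three_ne_zero).1 ?_
    have h1 : (δ ^ 2) ^ 3 * (j + 1 / 2) ^ 2 = 1 := by
      rw [show (δ ^ 2) ^ 3 * (j + 1 / 2 : ℝ) ^ 2 = (δ ^ 3 * (j + 1 / 2)) ^ 2 by ring, hm, one_pow]
    have h2 : (N : ℝ) ^ 2 ≤ 8 * (j + 1 / 2 : ℝ) ^ 2 := by nlinarith
    have h3 : q ^ 3 * N ^ 2 ≤ q ^ 3 * (8 * (j + 1 / 2 : ℝ) ^ 2) := by gcongr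
    have h4 : 0 < (j + 1 / 2 : ℝ) ^ 2 := by positivity
    refine le_of_mul_le_mul_right ?_ h4
    rw [h1]
    linarith
  refine (h N j δ (by omega) hj1.1 hj1.2 hδ hδ2 hBδ hm s ((neg_abs_le sL).trans hs)).trans ?_
  rw [mul_assoc C 3 q]
  gcongr
  linarith
end
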